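/- arXiv:1207.5062 — 2 statements merged into one kernel-verified Lean document; each statement's English description precedes it below -/
import Mathlib

section
/- Let d ≥ 2, let Λ ⊂ (0,1) be compact, and let γ ≥ 1. There exist a constant C < ∞ and a function ε : (0,∞) → (0,∞) with ε(δ) → 0 as δ → 0 (both depending only on d, Λ, γ) with the following property. For all sufficiently small δ > 0, all t ∈ Λ, and all γ-normalized Borel sets A, B ⊆ ℝ^d satisfying ||A| − 1| < δ, ||B| − 1| < δ, and |tA + (1−t)B| < 1 + δ: (i) for every η ≥ ε(δ), |A ∖ π^{−1}(𝒜(η))| ≤ Cη² and |B ∖ π^{−1}(ℬ(η))| ≤ Cη²; and (ii) for every s > 0, |𝒜(s)| ≤ |ℬ(s − ε(δ))| + ε(δ) and |ℬ(s)| ≤ |𝒜(s − ε(δ))| + ε(δ). -/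
open MeasureTheory Set Pointwise Filter ENNReal

noncomputable section

abbrev Edim (n : ℕ) := EuclideanSpace ℝ (Fin n)

/-- We identify `ℝ^d` with `ℝ^{d-1} × ℝ`. -/
abbrev Sp (n : ℕ) := Edim n × ℝ

/-- The vertical slice `A_x ⊆ ℝ` of a set `A ⊆ ℝ^{n} × ℝ`. -/
def vslice {n : ℕ} (A : Set (Sp n)) (x : Edim n) : Set ℝ := {y | (x, y) ∈ A}

/-- The horizontal slice of `A ⊆ ℝ^n × ℝ` at height `t`. -/
def hslice {n : ℕ} (A : Set (Sp n)) (t : ℝ) : Set (Edim n) := {x | (x, t) ∈ A}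

/-- Steiner symmetrization `A^⋆`: the slice `(A^⋆)_x` is the open interval
`(-|A_x|/2, |A_x|/2)` centered at `0` of length `|A_x|` (empty if `|A_x| = 0`). -/
def steiner {n : ℕ} (A : Set (Sp n)) : Set (Sp n) :=
  {p | ENNReal.ofReal (2 * |p.2|) < volume (vslice A p.1)}

/-- Schwarz symmetrization `A^*`: the horizontal slice of `A^*` at height `t` is the open
ball in `ℝ^n` centered at `0` whose measure equals that of the corresponding slice of `A`. -/
def schwarz {n : ℕ} (A : Set (Sp n)) : Set (Sp n) :=
  {p | volume (Metric.ball (0 : Edim n) ‖p.1‖) < volume (hslice A p.2)}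

/-- The symmetrization `A^♮ = (A^⋆)^*`. -/
def natSymm {n : ℕ} (A : Set (Sp n)) : Set (Sp n) := schwarz (steiner A)


/-- A Borel set `A ⊆ ℝ^{d-1} × ℝ` is `γ`-normalized if `|A| ≥ γ⁻¹`,
`sup_x |A_x| ≤ γ`, and `|π(A)| ≤ γ`. -/
def IsNormalized {n : ℕ} (γ : ℝ) (A : Set (Sp n)) : Prop :=
  ENNReal.ofReal γ⁻¹ ≤ volume A ∧
  (⨆ x : Edim n, volume (vslice A x)) ≤ ENNReal.ofReal γ ∧
  volume (Prod.fst '' A) ≤ ENNReal.ofReal γ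

/-- The superlevel set `𝒜(s) = {x ∈ ℝ^{d-1} : |A_x| > s}`; for `s < 0` this agrees with
`𝒜(0)`, since `ENNReal.ofReal s = 0` for `s ≤ 0`. -/
def levelSet {n : ℕ} (A : Set (Sp n)) (s : ℝ) : Set (Edim n) :=
  {x | ENNReal.ofReal s < volume (vslice A x)}

theorem volume_add_volume_le_of_isCompact {U V : Set ℝ} (hU : IsCompact U) (hV : IsCompact V)
    (hU' : U.Nonempty) (hV' : V.Nonempty) : volume U + volume V ≤ volume (U + V) := by
  obtain ⟨a, haU, ha⟩ := hU.exists_isGreatest hU'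
  obtain ⟨b, hbV, hb⟩ := hV.exists_isLeast hV'
  have hle : (b +ᵥ U) ∪ (a +ᵥ V) ⊆ U + V := by
    rintro _ (⟨x, hx, rfl⟩ | ⟨x, hx, rfl⟩)
    · exact ⟨x, hx, b, hbV, add_comm _ _⟩
    · exact ⟨a, haU, x, hx, rfl⟩
  have hdisj : AEDisjoint volume (b +ᵥ U) (a +ᵥ V) := by
    refine measure_mono_null (t := {a + b}) ?_ (by simp)
    rintro _ ⟨⟨x, hx, rfl⟩, ⟨y, hy, hxy⟩⟩
    have h1 := ha hx
    have h2 := hb hy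
    simp only [vadd_eq_add, mem_singleton_iff] at hxy ⊢
    linarith
  calc volume U + volume V = volume (b +ᵥ U) + volume (a +ᵥ V) := by
        rw [measure_vadd, measure_vadd]
    _ = volume ((b +ᵥ U) ∪ (a +ᵥ V)) :=
        (measure_union₀ (hV.vadd a).measurableSet.nullMeasurableSet hdisj).symm
    _ ≤ _ := measure_mono hle

theorem volume_add_volume_le {U V : Set ℝ} (hU : MeasurableSet U) (hV : MeasurableSet V)
    (hU' : U.Nonempty) (hV' : V.Nonempty) : volume U + volume V ≤ volume (U + V) := by
  have key : ∀ L ⊆ V, IsCompact L → L.Nonempty → volume U + volume L ≤ volume (U + V) := by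
    intro L hLV hL hL'
    have : volume U ≤ volume (U + V) - volume L := by
      refine le_of_forall_lt_imp_le_of_dense fun r hr => ?_
      obtain ⟨K, hKU, hK, hrK⟩ := hU.exists_lt_isCompact hr
      have hKne : K.Nonempty := by
        rw [nonempty_iff_ne_empty]; rintro rfl; simp at hrK
      refine hrK.le.trans (ENNReal.le_sub_of_add_le_right hL.measure_lt_top.ne ?_)
      exact (volume_add_volume_le_of_isCompact hK hL hKne hL').trans
        (measure_mono (add_subset_add hKU hLV))
    have hUV : volume L ≤ volume (U + V) := by
      obtain ⟨u, hu⟩ := hU'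
      calc volume L = volume (u +ᵥ L) := (measure_vadd _ _ _).symm
        _ ≤ _ := measure_mono (by rintro _ ⟨x, hx, rfl⟩; exact ⟨u, hu, x, hLV hx, rfl⟩)
    calc _ ≤ volume (U + V) - volume L + volume L := by gcongr
      _ = _ := tsub_add_cancel_of_le hUV
  by_cases hVtop : volume U = ∞
  · obtain ⟨v, hv⟩ := hV'
    have := key {v} (by simpa using hv) isCompact_singleton (singleton_nonempty v)
    rw [hVtop, top_add] at this ⊢
    exact this
  · have : volume V ≤ volume (U + V) - volume U := by
      refine le_of_forall_lt_imp_le_of_dense fun r hr => ?_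
      obtain ⟨K, hKV, hK, hrK⟩ := hV.exists_lt_isCompact hr
      have hKne : K.Nonempty := by
        rw [nonempty_iff_ne_empty]; rintro rfl; simp at hrK
      refine hrK.le.trans (ENNReal.le_sub_of_add_le_left hVtop (key K hKV hK hKne))
    have hUV : volume U ≤ volume (U + V) := by
      obtain ⟨v, hv⟩ := hV'
      simpa using key {v} (by simpa using hv) isCompact_singleton (singleton_nonempty v)
    calc _ ≤ volume U + (volume (U + V) - volume U) := by gcongr
      _ = _ := add_tsub_cancel_of_le hUV

/-- One-dimensional Brunn-Minkowski inequality for convex combinations of measurable sets. -/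
theorem ofReal_mul_volume_add_le {t : ℝ} (ht : 0 < t) (ht1 : t < 1) {X Y : Set ℝ}
    (hX : MeasurableSet X) (hY : MeasurableSet Y) (hX' : X.Nonempty) (hY' : Y.Nonempty) :
    ENNReal.ofReal t * volume X + ENNReal.ofReal (1 - t) * volume Y ≤
      volume (t • X + (1 - t) • Y) := by
  have h := volume_add_volume_le (hX.const_smul₀ t) (hY.const_smul₀ (1 - t))
    (hX'.smul_set (a := t)) (hY'.smul_set (a := 1 - t))
  rw [Measure.addHaar_smul, Measure.addHaar_smul] at h
  simpa [abs_of_pos ht, abs_of_pos (sub_pos.2 ht1)] using h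

theorem lintegral_convexCombo_le_of_min_le {t : ℝ} (ht : 0 < t) (ht1 : t < 1) {f g h : ℝ → ℝ}
    (hf : Measurable f) (hg : Measurable g) (hh : Measurable h)
    (hf0 : ∀ x, 0 ≤ f x) (hg0 : ∀ x, 0 ≤ g x) (hh0 : ∀ x, 0 ≤ h x)
    (hf1 : ∀ x, f x ≤ 1) (hg1 : ∀ x, g x ≤ 1)
    (hfs : ∀ v < 1, ∃ x, v < f x) (hgs : ∀ v < 1, ∃ x, v < g x)
    (H : ∀ x y, min (f x) (g y) ≤ h (t * x + (1 - t) * y)) :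
    ENNReal.ofReal t * (∫⁻ x, ENNReal.ofReal (f x)) +
      ENNReal.ofReal (1 - t) * (∫⁻ x, ENNReal.ofReal (g x)) ≤ ∫⁻ x, ENNReal.ofReal (h x) := by
  rw [lintegral_eq_lintegral_meas_lt _ (ae_of_all _ hf0) hf.aemeasurable,
    lintegral_eq_lintegral_meas_lt _ (ae_of_all _ hg0) hg.aemeasurable,
    lintegral_eq_lintegral_meas_lt _ (ae_of_all _ hh0) hh.aemeasurable]
  refine (add_le_add (lintegral_const_mul_le _ _) (lintegral_const_mul_le _ _)).trans
    ((le_lintegral_add _ _).trans (lintegral_mono fun v => ?_))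
  rcases lt_or_ge v 1 with hv | hv
  · refine (ofReal_mul_volume_add_le ht ht1 (measurableSet_lt measurable_const hf)
      (measurableSet_lt measurable_const hg) (hfs v hv) (hgs v hv)).trans (measure_mono ?_)
    rintro _ ⟨_, ⟨x, hx, rfl⟩, _, ⟨y, hy, rfl⟩, rfl⟩
    exact (lt_min hx hy).trans_le (H x y)
  · have h1 : {a | v < f a} = ∅ := by
      ext x; simpa using (hf1 x).trans hv
    have h2 : {a | v < g a} = ∅ := by
      ext x; simpa using (hg1 x).trans hv
    simp [h1, h2]

/-- A sharpened one-dimensional Prékopa-Leindler inequality. -/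
theorem prekopaLeindler_of_isLUB {t : ℝ} (ht : 0 < t) (ht1 : t < 1) {f g h : ℝ → ℝ}
    (hf : Measurable f) (hg : Measurable g) (hh : Measurable h)
    (hf0 : ∀ x, 0 ≤ f x) (hg0 : ∀ x, 0 ≤ g x) (hh0 : ∀ x, 0 ≤ h x)
    (hfi : Integrable f) (hgi : Integrable g) (hhi : Integrable h) {p q : ℝ}
    (hp : 0 < p) (hq : 0 < q)
    (hfp : IsLUB (range f) p) (hgq : IsLUB (range g) q)
    (H : ∀ x y, f x ^ t * g y ^ (1 - t) ≤ h (t * x + (1 - t) * y)) :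
    p ^ t * q ^ (1 - t) * (t * ((∫ x, f x) / p) + (1 - t) * ((∫ x, g x) / q)) ≤ ∫ x, h x := by
  set M := p ^ t * q ^ (1 - t) with hM
  have hMpos : 0 < M := by positivity
  have ht1' : 0 < 1 - t := sub_pos.2 ht1
  have sup_aux : ∀ {φ : ℝ → ℝ} {r : ℝ}, 0 < r → IsLUB (range φ) r → ∀ v < 1, ∃ x, v < φ x / r := by
    intro φ r hr hφ v hv
    obtain ⟨_, ⟨x, rfl⟩, hx⟩ := (lt_isLUB_iff hφ).1 (show v * r < r by nlinarith)
    exact ⟨x, by rwa [lt_div_iff₀ hr]⟩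
  have key := lintegral_convexCombo_le_of_min_le ht ht1 (hf.div_const p) (hg.div_const q)
    (hh.div_const M) (fun x => div_nonneg (hf0 x) hp.le) (fun x => div_nonneg (hg0 x) hq.le)
    (fun x => div_nonneg (hh0 x) hMpos.le)
    (fun x => (div_le_one hp).2 (hfp.1 ⟨x, rfl⟩)) (fun x => (div_le_one hq).2 (hgq.1 ⟨x, rfl⟩))
    (sup_aux hp hfp) (sup_aux hq hgq) (by
      intro x y
      have h1 : min (f x / p) (g y / q) ≤ (f x / p) ^ t * (g y / q) ^ (1 - t) := by
        set m := min (f x / p) (g y / q)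
        have hm0 : 0 ≤ m := le_min (div_nonneg (hf0 x) hp.le) (div_nonneg (hg0 y) hq.le)
        calc m = m ^ t * m ^ (1 - t) := by
              rw [← Real.rpow_add' hm0 (by simp)]; simp
          _ ≤ (f x / p) ^ t * (g y / q) ^ (1 - t) :=
              mul_le_mul (Real.rpow_le_rpow hm0 (min_le_left _ _) ht.le)
                (Real.rpow_le_rpow hm0 (min_le_right _ _) ht1'.le) (by positivity)
                (Real.rpow_nonneg (div_nonneg (hf0 x) hp.le) _)
      refine h1.trans ?_
      rw [Real.div_rpow (hf0 x) hp.le, Real.div_rpow (hg0 y) hq.le, div_mul_div_comm]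
      gcongr
      exact H x y)
  rw [← ofReal_integral_eq_lintegral_ofReal (hfi.div_const p)
      (ae_of_all _ fun x => div_nonneg (hf0 x) hp.le),
    ← ofReal_integral_eq_lintegral_ofReal (hgi.div_const q)
      (ae_of_all _ fun x => div_nonneg (hg0 x) hq.le),
    ← ofReal_integral_eq_lintegral_ofReal (hhi.div_const M)
      (ae_of_all _ fun x => div_nonneg (hh0 x) hMpos.le),
    ← ENNReal.ofReal_mul ht.le, ← ENNReal.ofReal_mul ht1'.le, ← ENNReal.ofReal_add
      (mul_nonneg ht.le (integral_nonneg fun x => div_nonneg (hf0 x) hp.le))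
      (mul_nonneg ht1'.le (integral_nonneg fun x => div_nonneg (hg0 x) hq.le)),
    ENNReal.ofReal_le_ofReal_iff (integral_nonneg fun x => div_nonneg (hh0 x) hMpos.le),
    integral_div, integral_div, integral_div, le_div_iff₀ hMpos] at key
  linarith

theorem rpow_mul_rpow_le_of_isLUB_bound {t p q a b : ℝ} (ht : 0 < t) (ht1 : t < 1) (hp : 0 < p)
    (hq : 0 < q) (ha : 0 ≤ a) (hb : 0 ≤ b) :
    a ^ t * b ^ (1 - t) ≤ p ^ t * q ^ (1 - t) * (t * (a / p) + (1 - t) * (b / q)) := by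
  have h := Real.geom_mean_le_arith_mean2_weighted ht.le (sub_pos.2 ht1).le
    (div_nonneg ha hp.le) (div_nonneg hb hq.le) (by ring)
  rw [Real.div_rpow ha hp.le, Real.div_rpow hb hq.le, div_mul_div_comm,
    div_le_iff₀ (by positivity)] at h
  linarith

theorem brunnMinkowski_prod {n : ℕ} {t : ℝ} (ht : 0 < t) (ht1 : t < 1)
    (ih : ∀ X Y : Set (Fin n → ℝ), IsCompact X → IsCompact Y →
      volume.real X ^ t * volume.real Y ^ (1 - t) ≤ volume.real (t • X + (1 - t) • Y))
    {X Y : Set (ℝ × (Fin n → ℝ))} (hX : IsCompact X) (hY : IsCompact Y) :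
    volume.real X ^ t * volume.real Y ^ (1 - t) ≤ volume.real (t • X + (1 - t) • Y) := by
  have ht1' : 0 < 1 - t := sub_pos.2 ht1
  have hZ : IsCompact (t • X + (1 - t) • Y) := (hX.smul t).add (hY.smul (1 - t))
  have sliceC : ∀ {S : Set (ℝ × (Fin n → ℝ))}, IsCompact S → ∀ x,
      IsCompact (Prod.mk x ⁻¹' S) := by
    intro S hS x
    refine (hS.image continuous_snd).of_isClosed_subset
      (hS.isClosed.preimage (Continuous.prodMk_right x)) ?_
    intro y hy
    exact ⟨(x, y), hy, rfl⟩
  have meas : ∀ {S : Set (ℝ × (Fin n → ℝ))}, IsCompact S →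
      Measurable fun x => volume.real (Prod.mk x ⁻¹' S) := fun hS =>
    (measurable_measure_prodMk_left hS.measurableSet).ennreal_toReal
  have integ : ∀ {S : Set (ℝ × (Fin n → ℝ))}, IsCompact S →
      Integrable fun x => volume.real (Prod.mk x ⁻¹' S) := fun hS =>
    Measure.integrable_measure_prodMk_left hS.measurableSet hS.measure_lt_top.ne
  have intEq : ∀ {S : Set (ℝ × (Fin n → ℝ))}, IsCompact S →
      ∫ x, volume.real (Prod.mk x ⁻¹' S) = volume.real S := by
    intro S hS
    rw [integral_eq_lintegral_of_nonneg_ae (ae_of_all _ fun _ => measureReal_nonneg)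
      (meas hS).aestronglyMeasurable, measureReal_def, Measure.volume_eq_prod,
      Measure.prod_apply hS.measurableSet]
    congr 1
    refine lintegral_congr fun x => ?_
    rw [measureReal_def, ENNReal.ofReal_toReal (sliceC hS x).measure_lt_top.ne]
  have bdd : ∀ {S : Set (ℝ × (Fin n → ℝ))}, IsCompact S →
      BddAbove (range fun x => volume.real (Prod.mk x ⁻¹' S)) := by
    rintro S hS
    refine ⟨volume.real (Prod.snd '' S), ?_⟩
    rintro _ ⟨x, rfl⟩
    exact measureReal_mono (fun y hy => ⟨(x, y), hy, rfl⟩)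
      (hS.image continuous_snd).measure_lt_top.ne
  have sup : ∀ {S : Set (ℝ × (Fin n → ℝ))}, IsCompact S → 0 < volume.real S →
      ∃ p, 0 < p ∧ IsLUB (range fun x => volume.real (Prod.mk x ⁻¹' S)) p := by
    intro S hS hpos
    refine ⟨_, ?_, isLUB_csSup (range_nonempty _) (bdd hS)⟩
    by_contra! hle
    have : ∀ x, volume.real (Prod.mk x ⁻¹' S) = 0 := fun x =>
      le_antisymm ((le_csSup (bdd hS) ⟨x, rfl⟩).trans hle) measureReal_nonneg
    rw [← intEq hS] at hpos
    simp [this] at hpos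
  rcases (measureReal_nonneg (μ := volume) (s := X)).eq_or_lt with h0 | hXpos
  · rw [← h0, Real.zero_rpow ht.ne', zero_mul]; exact measureReal_nonneg
  rcases (measureReal_nonneg (μ := volume) (s := Y)).eq_or_lt with h0 | hYpos
  · rw [← h0, Real.zero_rpow ht1'.ne', mul_zero]; exact measureReal_nonneg
  obtain ⟨p, hp, hpX⟩ := sup hX hXpos
  obtain ⟨q, hq, hqY⟩ := sup hY hYpos
  have := prekopaLeindler_of_isLUB ht ht1 (meas hX) (meas hY) (meas hZ)
    (fun _ => measureReal_nonneg) (fun _ => measureReal_nonneg) (fun _ => measureReal_nonneg)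
    (integ hX) (integ hY) (integ hZ) hp hq hpX hqY (by
      intro x y
      refine (ih _ _ (sliceC hX x) (sliceC hY y)).trans
        (measureReal_mono ?_ (sliceC hZ _).measure_lt_top.ne)
      rintro _ ⟨_, ⟨u, hu, rfl⟩, _, ⟨v, hv, rfl⟩, rfl⟩
      exact ⟨t • (x, u), ⟨_, hu, rfl⟩, (1 - t) • (y, v), ⟨_, hv, rfl⟩, rfl⟩)
  rw [intEq hX, intEq hY, intEq hZ] at this
  exact (rpow_mul_rpow_le_of_isLUB_bound ht ht1 hp hq measureReal_nonneg measureReal_nonneg).trans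
    this

theorem brunnMinkowski_pi {t : ℝ} (ht : 0 < t) (ht1 : t < 1) (n : ℕ) (X Y : Set (Fin n → ℝ))
    (hX : IsCompact X) (hY : IsCompact Y) :
    volume.real X ^ t * volume.real Y ^ (1 - t) ≤ volume.real (t • X + (1 - t) • Y) := by
  induction n with
  | zero =>
    rcases X.eq_empty_or_nonempty with rfl | hXn
    · simp [Real.zero_rpow ht.ne']
    rcases Y.eq_empty_or_nonempty with rfl | hYn
    · simp [Real.zero_rpow (sub_pos.2 ht1).ne']
    have hZ : (t • X + (1 - t) • Y).Nonempty := hXn.smul_set.add hYn.smul_set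
    rw [hZ.eq_univ, hXn.eq_univ, hYn.eq_univ]
    simp [measureReal_def, volume_pi]
  | succ n ih =>
    let e := MeasurableEquiv.piFinSuccAbove (fun _ : Fin (n + 1) => ℝ) 0
    have he : MeasurePreserving e volume volume :=
      volume_preserving_piFinSuccAbove (fun _ : Fin (n + 1) => ℝ) 0
    have hec : Continuous e := by
      refine (continuous_apply 0).prodMk (continuous_pi fun i => continuous_apply _)
    have hvol : ∀ S, volume.real (e '' S) = volume.real S := by
      intro S
      rw [measureReal_def, measureReal_def, ← he.measure_preimage_equiv, e.injective.preimage_image]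
    have him : e '' (t • X + (1 - t) • Y) = t • (e '' X) + (1 - t) • (e '' Y) := by
      have hlin : ∀ x y, e (t • x + (1 - t) • y) = t • e x + (1 - t) • e y := fun x y => rfl
      ext z
      constructor
      · rintro ⟨_, ⟨_, ⟨x, hx, rfl⟩, _, ⟨y, hy, rfl⟩, rfl⟩, rfl⟩
        exact ⟨t • e x, ⟨_, ⟨x, hx, rfl⟩, rfl⟩, (1 - t) • e y, ⟨_, ⟨y, hy, rfl⟩, rfl⟩, rfl⟩
      · rintro ⟨_, ⟨_, ⟨x, hx, rfl⟩, rfl⟩, _, ⟨_, ⟨y, hy, rfl⟩, rfl⟩, rfl⟩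
        exact ⟨_, ⟨t • x, ⟨x, hx, rfl⟩, (1 - t) • y, ⟨y, hy, rfl⟩, rfl⟩, hlin x y⟩
    have := brunnMinkowski_prod ht ht1 ih (hX.image hec) (hY.image hec)
    rwa [← him, hvol, hvol, hvol] at this

theorem brunnMinkowski_euclidean_of_isCompact {t : ℝ} (ht : 0 < t) (ht1 : t < 1) {n : ℕ}
    {X Y : Set (EuclideanSpace ℝ (Fin n))} (hX : IsCompact X) (hY : IsCompact Y) :
    volume.real X ^ t * volume.real Y ^ (1 - t) ≤ volume.real (t • X + (1 - t) • Y) := by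
  let e := (MeasurableEquiv.toLp 2 (Fin n → ℝ)).symm
  have he : MeasurePreserving e volume volume :=
    EuclideanSpace.volume_preserving_symm_measurableEquiv_toLp (Fin n)
  have hec : Continuous e := PiLp.continuous_ofLp 2 _
  have hvol : ∀ S, volume.real (e '' S) = volume.real S := by
    intro S
    rw [measureReal_def, measureReal_def, ← he.measure_preimage_equiv, e.injective.preimage_image]
  have him : e '' (t • X + (1 - t) • Y) = t • (e '' X) + (1 - t) • (e '' Y) := by
    have hlin : ∀ x y, e (t • x + (1 - t) • y) = t • e x + (1 - t) • e y := fun x y => rfl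
    ext z
    constructor
    · rintro ⟨_, ⟨_, ⟨x, hx, rfl⟩, _, ⟨y, hy, rfl⟩, rfl⟩, rfl⟩
      exact ⟨t • e x, ⟨_, ⟨x, hx, rfl⟩, rfl⟩, (1 - t) • e y, ⟨_, ⟨y, hy, rfl⟩, rfl⟩, rfl⟩
    · rintro ⟨_, ⟨_, ⟨x, hx, rfl⟩, rfl⟩, _, ⟨_, ⟨y, hy, rfl⟩, rfl⟩, rfl⟩
      exact ⟨_, ⟨t • x, ⟨x, hx, rfl⟩, (1 - t) • y, ⟨y, hy, rfl⟩, rfl⟩, hlin x y⟩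
  have := brunnMinkowski_pi ht ht1 n _ _ (hX.image hec) (hY.image hec)
  rwa [← him, hvol, hvol, hvol] at this

/-- Multiplicative Brunn-Minkowski inequality; the sumset need not be measurable. -/
theorem brunnMinkowski_euclidean {t : ℝ} (ht : 0 < t) (ht1 : t < 1) {n : ℕ}
    {X Y Z : Set (EuclideanSpace ℝ (Fin n))} (hX : MeasurableSet X) (hY : MeasurableSet Y)
    (hX' : volume X ≠ ∞) (hY' : volume Y ≠ ∞) (hZ' : volume Z ≠ ∞)
    (hZ : t • X + (1 - t) • Y ⊆ Z) :
    volume.real X ^ t * volume.real Y ^ (1 - t) ≤ volume.real Z := by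
  have ht1' : 0 < 1 - t := sub_pos.2 ht1
  have approx : ∀ {S : Set (EuclideanSpace ℝ (Fin n))}, MeasurableSet S → volume S ≠ ∞ →
      ∀ k : ℕ, ∃ K ⊆ S, IsCompact K ∧ volume.real S - 1 / (k + 1) ≤ volume.real K := by
    intro S hS hS' k
    obtain ⟨K, hKS, hK, hlt⟩ := hS.exists_isCompact_lt_add hS' (ε := ENNReal.ofReal (1 / (k + 1)))
      (by simp; positivity)
    refine ⟨K, hKS, hK, ?_⟩
    have h := ENNReal.toReal_mono (by simp [hK.measure_lt_top.ne]) hlt.le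
    rw [ENNReal.toReal_add hK.measure_lt_top.ne ENNReal.ofReal_ne_top,
      ENNReal.toReal_ofReal (by positivity)] at h
    simp only [measureReal_def]
    linarith
  choose K hKX hK hKv using approx hX hX'
  choose L hLY hL hLv using approx hY hY'
  have lim : ∀ {S : Set (EuclideanSpace ℝ (Fin n))} {K : ℕ → Set (EuclideanSpace ℝ (Fin n))},
      (∀ k, K k ⊆ S) → volume S ≠ ∞ → (∀ k : ℕ, volume.real S - 1 / (k + 1) ≤ volume.real (K k)) →
      Tendsto (fun k => volume.real (K k)) atTop (nhds (volume.real S)) := by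
    intro S K hKS hS' h
    refine tendsto_of_tendsto_of_tendsto_of_le_of_le ?_ tendsto_const_nhds h
      (fun k => measureReal_mono (hKS k) hS')
    simpa using (tendsto_const_nhds (x := volume.real S)).sub
      (tendsto_one_div_add_atTop_nhds_zero_nat (𝕜 := ℝ))
  refine le_of_tendsto' (((lim hKX hX' hKv).rpow_const (Or.inr ht.le)).mul
    ((lim hLY hY' hLv).rpow_const (Or.inr ht1'.le))) fun k => ?_
  refine (brunnMinkowski_euclidean_of_isCompact ht ht1 (hK k) (hL k)).trans
    (measureReal_mono ?_ hZ')
  exact (add_subset_add (smul_set_mono (hKX k)) (smul_set_mono (hLY k))).trans hZ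

theorem integral_indicator_Icc (F : ℝ → ℝ) {a b : ℝ} (hab : a ≤ b) :
    ∫ x, (Icc a b).indicator F x = ∫ x in a..b, F x := by
  rw [integral_indicator measurableSet_Icc, integral_Icc_eq_integral_Ioc,
    intervalIntegral.integral_of_le hab]

/-- Nonincreasing functions with values in `[0, γ]` that vanish on `[γ, ∞)`. -/
structure IsProfile (γ : ℝ) (F : ℝ → ℝ) : Prop where
  anti : Antitone F
  nonneg : ∀ s, 0 ≤ F s
  le : ∀ s, F s ≤ γ
  eq_zero : ∀ s, γ ≤ s → F s = 0

namespace IsProfile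

variable {γ : ℝ} {F : ℝ → ℝ}

theorem intervalIntegrable (hF : IsProfile γ F) (a b : ℝ) : IntervalIntegrable F volume a b :=
  hF.anti.intervalIntegrable

theorem integral_nonneg (hF : IsProfile γ F) {a b : ℝ} (hab : a ≤ b) : 0 ≤ ∫ x in a..b, F x :=
  intervalIntegral.integral_nonneg hab fun x _ => hF.nonneg x

theorem integral_add (hF : IsProfile γ F) (a b c : ℝ) :
    (∫ x in a..b, F x) + ∫ x in b..c, F x = ∫ x in a..c, F x :=
  intervalIntegral.integral_add_adjacent_intervals (hF.intervalIntegrable _ _)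
    (hF.intervalIntegrable _ _)

theorem integral_le (hF : IsProfile γ F) {a b : ℝ} (hab : a ≤ b) :
    ∫ x in a..b, F x ≤ (b - a) * F a := by
  have := intervalIntegral.integral_mono_on hab (hF.intervalIntegrable a b)
    (intervalIntegrable_const (c := F a)) fun x hx => hF.anti hx.1
  simpa using this

theorem le_integral (hF : IsProfile γ F) {a b : ℝ} (hab : a ≤ b) :
    (b - a) * F b ≤ ∫ x in a..b, F x := by
  have := intervalIntegral.integral_mono_on hab (intervalIntegrable_const (c := F b))
    (hF.intervalIntegrable a b) fun x hx => hF.anti hx.2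
  simpa using this

theorem continuous_integral (hF : IsProfile γ F) : Continuous fun s => ∫ x in (0 : ℝ)..s, F x :=
  intervalIntegral.continuous_primitive (fun a b => hF.intervalIntegrable a b) 0

theorem integral_mono (hF : IsProfile γ F) {a b : ℝ} (hab : a ≤ b) :
    ∫ x in (0 : ℝ)..a, F x ≤ ∫ x in (0 : ℝ)..b, F x := by
  rw [← hF.integral_add 0 a b]
  linarith [hF.integral_nonneg hab]

theorem integral_le_total (hF : IsProfile γ F) (s : ℝ) :
    ∫ x in (0 : ℝ)..s, F x ≤ ∫ x in (0 : ℝ)..γ, F x := by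
  rcases le_total s γ with h | h
  · exact hF.integral_mono h
  · have := hF.integral_le h
    rw [hF.eq_zero γ le_rfl] at this
    rw [← hF.integral_add 0 γ s]
    linarith

theorem tail_le (hF : IsProfile γ F) {a : ℝ} (ha : 0 ≤ a) :
    (∫ x in (0 : ℝ)..γ, F x) - ∫ x in (0 : ℝ)..a, F x ≤ γ * F a := by
  rcases le_total a γ with h | h
  · have := hF.integral_le h
    rw [← hF.integral_add 0 a γ]
    nlinarith [hF.nonneg a]
  · have := hF.integral_mono h
    rw [hF.eq_zero a h]
    linarith

theorem lt_of_pos (hF : IsProfile γ F) {a : ℝ} (ha : 0 < F a) : a < γ := by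
  by_contra! h
  exact ha.ne' (hF.eq_zero a h)

theorem measurable (hF : IsProfile γ F) : Measurable F := hF.anti.measurable

theorem integrable_indicator (hF : IsProfile γ F) (a b : ℝ) :
    Integrable ((Icc a b).indicator F) :=
  (hF.anti.antitoneOn _).integrableOn_isCompact isCompact_Icc |>.integrable_indicator
    measurableSet_Icc

theorem isLUB_indicator (hF : IsProfile γ F) {a b : ℝ} (hab : a ≤ b) :
    IsLUB (range ((Icc a b).indicator F)) (F a) := by
  refine IsGreatest.isLUB ⟨⟨a, indicator_of_mem (left_mem_Icc.2 hab) _⟩, ?_⟩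
  rintro _ ⟨x, rfl⟩
  exact indicator_apply_le' (fun hx => hF.anti hx.1) fun _ => hF.nonneg a

theorem add_le_of_integral_close {G : ℝ → ℝ} (hF : IsProfile γ F) (hG : IsProfile γ G) {κ θ : ℝ}
    (hθ : 0 < θ) (hκθ : 2 * κ ≤ θ ^ 2)
    (h : ∀ s, 0 ≤ s → |(∫ x in (0 : ℝ)..s, F x) - ∫ x in (0 : ℝ)..s, G x| ≤ κ) {s : ℝ}
    (hs : 0 ≤ s) : F (s + θ) ≤ G s + θ := by
  have h1 := hF.le_integral (show s ≤ s + θ by linarith)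
  have h2 := hG.integral_le (show s ≤ s + θ by linarith)
  have h3 := (abs_le.1 (h s hs)).1
  have h4 := (abs_le.1 (h (s + θ) (by linarith))).2
  rw [← hF.integral_add 0 s, ← hG.integral_add 0 s] at h4
  have : θ * F (s + θ) ≤ θ * (G s + θ) := by nlinarith
  exact le_of_mul_le_mul_left this hθ

end IsProfile

/-- Distribution functions `F`, `G`, `H` related by a multiplicative Brunn-Minkowski inequality
that is nearly saturated. -/
structure NearSaturated (lam γ δ t : ℝ) (F G H : ℝ → ℝ) : Prop where
  lam_pos : 0 < lam
  lam_le : lam ≤ t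
  lam_le' : lam ≤ 1 - t
  one_le : 1 ≤ γ
  left : IsProfile γ F
  right : IsProfile γ G
  sum : IsProfile γ H
  le_sum : ∀ s s', 0 ≤ s → 0 ≤ s' → F s ^ t * G s' ^ (1 - t) ≤ H (t * s + (1 - t) * s')
  δ_nonneg : 0 ≤ δ
  δ_le : δ ≤ 1 / 2
  left_ge : 1 - δ ≤ ∫ x in (0 : ℝ)..γ, F x
  left_le : ∫ x in (0 : ℝ)..γ, F x ≤ 1 + δ
  right_ge : 1 - δ ≤ ∫ x in (0 : ℝ)..γ, G x
  right_le : ∫ x in (0 : ℝ)..γ, G x ≤ 1 + δ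
  sum_le : ∫ x in (0 : ℝ)..γ, H x ≤ 1 + δ

theorem one_add_sq_log_le {t p q : ℝ} (ht : 0 < t) (ht1 : t < 1) (hq : 0 < q) (hqp : q ≤ p) :
    1 + (1 - t) * t ^ 2 * Real.log (p / q) ^ 2 / 2 ≤
      p ^ t * q ^ (1 - t) * (t / p + (1 - t) / q) := by
  have hp : 0 < p := hq.trans_le hqp
  set x := Real.log (p / q) with hx
  have hx0 : 0 ≤ x := Real.log_nonneg ((one_le_div hq).2 hqp)
  have hpx : p = q * Real.exp x := by
    rw [hx, Real.exp_log (div_pos hp hq)]; field_simp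
  have h1 : p ^ t * q ^ (1 - t) = q * Real.exp (t * x) := by
    rw [hpx, Real.mul_rpow hq.le (Real.exp_pos x).le, ← Real.exp_mul, mul_right_comm,
      ← Real.rpow_add hq]
    simp [mul_comm x t]
  have h2 : Real.exp (t * x) = Real.exp (t * x - x) * Real.exp x := by
    rw [← Real.exp_add]; ring_nf
  have h3 : p ^ t * q ^ (1 - t) * (t / p + (1 - t) / q) =
      t * Real.exp (t * x - x) + (1 - t) * Real.exp (t * x) := by
    rw [h1]
    nth_rewrite 2 [h2]
    rw [hpx, h2]
    have := Real.exp_pos x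
    field_simp
  rw [h3]
  have h4 := Real.add_one_le_exp (t * x - x)
  have h5 := Real.quadratic_le_exp_of_nonneg (mul_nonneg ht.le hx0)
  nlinarith

theorem sub_le_of_mean_le {lam γ δ t p q m τ X : ℝ} (hl : 0 < lam) (hlt : lam ≤ t)
    (hlt' : lam ≤ 1 - t) (hp : 0 < p) (hq : 0 < q) (hpγ : p ≤ γ) (hX : 0 ≤ X) (hτ : 0 < τ)
    (hτm : τ ≤ m) (h : p ^ t * q ^ (1 - t) * (t / p + (1 - t) / q) * m ≤ m + 2 * δ)
    (hδ : 4 * δ ≤ lam ^ 3 * X ^ 2 * τ) : p - q ≤ γ * X := by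
  rcases le_total p q with hpq | hqp
  · nlinarith [mul_nonneg (hp.le.trans hpγ) hX]
  have key := one_add_sq_log_le (hl.trans_le hlt) (by linarith) hq hqp
  set x := Real.log (p / q) with hx
  have hx0 : 0 ≤ x := Real.log_nonneg ((one_le_div hq).2 hqp)
  have hm : 0 < m := hτ.trans_le hτm
  have ht' : 0 ≤ 1 - t := hl.le.trans hlt'
  have h1 : (1 + (1 - t) * t ^ 2 * x ^ 2 / 2) * m ≤ m + 2 * δ :=
    (mul_le_mul_of_nonneg_right key hm.le).trans h
  have h2 : lam ^ 3 ≤ (1 - t) * t ^ 2 := by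
    calc lam ^ 3 = lam * lam ^ 2 := by ring
      _ ≤ _ := by gcongr
  have h3 : lam ^ 3 * x ^ 2 * τ ≤ (1 - t) * t ^ 2 * x ^ 2 * m := by
    have : 0 ≤ (1 - t) * t ^ 2 := by positivity
    gcongr
  have h4 : lam ^ 3 * τ * x ^ 2 ≤ lam ^ 3 * τ * X ^ 2 := by nlinarith
  have hxX : x ≤ X := by
    have := le_of_mul_le_mul_left h4 (by positivity)
    exact (sq_le_sq₀ hx0 hX).1 this
  have h5 : q = p * Real.exp (-x) := by
    rw [Real.exp_neg, hx, Real.exp_log (div_pos hp hq)]; field_simp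
  have h6 := Real.add_one_le_exp (-x)
  calc p - q = p * (1 - Real.exp (-x)) := by nth_rewrite 1 [h5]; ring
    _ ≤ p * X := by gcongr; linarith
    _ ≤ γ * X := by gcongr

namespace NearSaturated

variable {lam γ δ t : ℝ} {F G H : ℝ → ℝ}

theorem swap (h : NearSaturated lam γ δ t F G H) : NearSaturated lam γ δ (1 - t) G F H where
  lam_pos := h.lam_pos
  lam_le := h.lam_le'
  lam_le' := by simpa using h.lam_le
  one_le := h.one_le
  left := h.right
  right := h.left
  sum := h.sum
  le_sum s s' hs hs' := by
    have := h.le_sum s' s hs' hs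
    rw [sub_sub_self, mul_comm, add_comm]
    exact this
  δ_nonneg := h.δ_nonneg
  δ_le := h.δ_le
  left_ge := h.right_ge
  left_le := h.right_le
  right_ge := h.left_ge
  right_le := h.left_le
  sum_le := h.sum_le

theorem t_pos (h : NearSaturated lam γ δ t F G H) : 0 < t := h.lam_pos.trans_le h.lam_le

theorem one_sub_t_pos (h : NearSaturated lam γ δ t F G H) : 0 < 1 - t :=
  h.lam_pos.trans_le h.lam_le'

theorem t_lt_one (h : NearSaturated lam γ δ t F G H) : t < 1 := sub_pos.1 h.one_sub_t_pos

theorem piece (h : NearSaturated lam γ δ t F G H) {a a' b b' : ℝ} (ha : 0 ≤ a) (hb : 0 ≤ b)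
    (haa' : a ≤ a') (hbb' : b ≤ b') (hp : 0 < F a) (hq : 0 < G b) :
    F a ^ t * G b ^ (1 - t) *
      (t * ((∫ x in a..a', F x) / F a) + (1 - t) * ((∫ x in b..b', G x) / G b)) ≤
      ∫ x in (t * a + (1 - t) * b)..(t * a' + (1 - t) * b'), H x := by
  have ht := h.t_pos
  have ht' := h.one_sub_t_pos
  have hcc : t * a + (1 - t) * b ≤ t * a' + (1 - t) * b' := by gcongr
  rw [← integral_indicator_Icc F haa', ← integral_indicator_Icc G hbb',
    ← integral_indicator_Icc H hcc]
  refine prekopaLeindler_of_isLUB ht h.t_lt_one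
    (h.left.measurable.indicator measurableSet_Icc) (h.right.measurable.indicator measurableSet_Icc)
    (h.sum.measurable.indicator measurableSet_Icc)
    (indicator_nonneg fun x _ => h.left.nonneg x) (indicator_nonneg fun x _ => h.right.nonneg x)
    (indicator_nonneg fun x _ => h.sum.nonneg x) (h.left.integrable_indicator _ _)
    (h.right.integrable_indicator _ _) (h.sum.integrable_indicator _ _) hp hq
    (h.left.isLUB_indicator haa') (h.right.isLUB_indicator hbb') ?_
  intro x y
  have hnn : 0 ≤ (Icc (t * a + (1 - t) * b) (t * a' + (1 - t) * b')).indicator H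
      (t * x + (1 - t) * y) := indicator_nonneg (fun x _ => h.sum.nonneg x) _
  by_cases hx : x ∈ Icc a a'
  · by_cases hy : y ∈ Icc b b'
    · rw [indicator_of_mem hx, indicator_of_mem hy, indicator_of_mem]
      · exact h.le_sum x y (ha.trans hx.1) (hb.trans hy.1)
      · obtain ⟨h1, h2⟩ := hx
        obtain ⟨h3, h4⟩ := hy
        constructor <;> gcongr
    · rw [indicator_of_notMem hy, Real.zero_rpow ht'.ne', mul_zero]
      exact hnn
  · rw [indicator_of_notMem hx, Real.zero_rpow ht.ne', zero_mul]
    exact hnn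

theorem left_zero_pos (h : NearSaturated lam γ δ t F G H) : 0 < F 0 := by
  have h1 := h.left.tail_le le_rfl
  have h2 := h.left_ge
  have h3 := h.δ_le
  have h4 := h.one_le
  rw [intervalIntegral.integral_same] at h1
  by_contra! hle
  nlinarith

theorem head (h : NearSaturated lam γ δ t F G H) {a b : ℝ} (ha : 0 ≤ a) (hb : 0 ≤ b)
    (hab : ∫ x in (0 : ℝ)..a, F x = ∫ x in (0 : ℝ)..b, G x) :
    ∫ x in (0 : ℝ)..a, F x ≤ ∫ x in (0 : ℝ)..(t * a + (1 - t) * b), H x := by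
  have h1 := h.piece le_rfl le_rfl ha hb h.left_zero_pos h.swap.left_zero_pos
  have h2 := rpow_mul_rpow_le_of_isLUB_bound h.t_pos h.t_lt_one h.left_zero_pos
    h.swap.left_zero_pos (h.left.integral_nonneg ha) (h.right.integral_nonneg hb)
  simp only [mul_zero, add_zero] at h1
  refine le_trans ?_ (h2.trans h1)
  rw [← hab, ← Real.rpow_add' (h.left.integral_nonneg ha) (by simp)]
  simp

theorem left_pos (h : NearSaturated lam γ δ t F G H) {a : ℝ} (ha : 0 ≤ a)
    (hu : ∫ x in (0 : ℝ)..a, F x < 1 - δ) : 0 < F a := by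
  have h1 := h.left.tail_le ha
  have h2 := h.left_ge
  have h4 := h.one_le
  by_contra! hle
  nlinarith

theorem tail (h : NearSaturated lam γ δ t F G H) {a b : ℝ} (ha : 0 ≤ a) (hb : 0 ≤ b)
    (hab : ∫ x in (0 : ℝ)..a, F x = ∫ x in (0 : ℝ)..b, G x)
    (hu : ∫ x in (0 : ℝ)..a, F x < 1 - δ) :
    F a ^ t * G b ^ (1 - t) * (t / F a + (1 - t) / G b) * (1 - δ - ∫ x in (0 : ℝ)..a, F x) ≤
      ∫ x in (t * a + (1 - t) * b)..γ, H x := by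
  have hp := h.left_pos ha hu
  have hq := h.swap.left_pos hb (hab ▸ hu)
  have h1 := h.piece ha hb (h.left.lt_of_pos hp).le (h.right.lt_of_pos hq).le hp hq
  rw [show t * γ + (1 - t) * γ = γ by ring] at h1
  refine le_trans ?_ h1
  have e1 := h.left.integral_add 0 a γ
  have e2 := h.right.integral_add 0 b γ
  have h2 : 1 - δ - ∫ x in (0 : ℝ)..a, F x ≤ ∫ x in a..γ, F x := by linarith [h.left_ge]
  have h3 : 1 - δ - ∫ x in (0 : ℝ)..a, F x ≤ ∫ x in b..γ, G x := by linarith [h.right_ge]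
  have ht := h.t_pos
  have ht' := h.one_sub_t_pos
  rw [mul_assoc]
  gcongr
  rw [add_mul, div_mul_eq_mul_div, div_mul_eq_mul_div, mul_div_assoc, mul_div_assoc]
  gcongr

theorem exists_match (h : NearSaturated lam γ δ t F G H) {c : ℝ} (hc : 0 ≤ c) :
    ∃ a b, 0 ≤ a ∧ 0 ≤ b ∧ t * a + (1 - t) * b = c ∧
      ∫ x in (0 : ℝ)..a, F x = ∫ x in (0 : ℝ)..b, G x := by
  have ht := h.t_pos
  have ht' := h.one_sub_t_pos
  have hcont : Continuous fun a => (∫ x in (0 : ℝ)..a, F x) -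
      ∫ x in (0 : ℝ)..((c - t * a) / (1 - t)), G x :=
    h.left.continuous_integral.sub (h.right.continuous_integral.comp (by fun_prop))
  have hct : 0 ≤ c / t := by positivity
  have hmem := intermediate_value_Icc hct hcont.continuousOn
  obtain ⟨a, ha, ha0⟩ := hmem (show (0 : ℝ) ∈ _ by
    constructor
    · simp only [intervalIntegral.integral_same, mul_zero, sub_zero, zero_sub,
        Left.neg_nonpos_iff]
      exact h.right.integral_nonneg (by positivity)
    · rw [mul_div_cancel₀ _ ht.ne']
      simpa using h.left.integral_nonneg hct)
  refine ⟨a, (c - t * a) / (1 - t), ha.1, ?_, ?_, sub_eq_zero.1 ha0⟩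
  · have := (le_div_iff₀ ht).1 ha.2
    apply div_nonneg _ ht'.le
    linarith
  · rw [mul_div_cancel₀ _ ht'.ne']; ring

theorem integral_sub_le (h : NearSaturated lam γ δ t F G H) {τ X : ℝ} (hX : 0 ≤ X) (hτ : 0 < τ)
    (hδ : 4 * δ ≤ lam ^ 3 * X ^ 2 * τ) {s : ℝ} (hs : 0 ≤ s) :
    (∫ x in (0 : ℝ)..s, F x) - ∫ x in (0 : ℝ)..s, G x ≤ γ ^ 2 * X + τ + 2 * δ := by
  have hγ := h.one_le
  have hδ0 := h.δ_nonneg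
  rcases le_or_gt (1 - δ - ∫ x in (0 : ℝ)..s, G x) τ with hlt | hlt
  · have := h.left.integral_le_total s
    have := h.left_le
    have : 0 ≤ γ ^ 2 * X := by positivity
    linarith
  have pointwise : ∀ r, 0 ≤ r → r ≤ s →
      ∫ x in (0 : ℝ)..r, G x ≤ ∫ x in (0 : ℝ)..r, F x → F r - G r ≤ γ * X := by
    intro r hr hrs hΔ
    obtain ⟨a, ha, haΦ⟩ := intermediate_value_Icc hr h.left.continuous_integral.continuousOn
      (show (∫ x in (0 : ℝ)..r, G x) ∈ _ by
        refine ⟨?_, hΔ⟩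
        simpa using h.right.integral_nonneg hr)
    simp only at haΦ
    have hu : τ < 1 - δ - ∫ x in (0 : ℝ)..a, F x := by
      rw [haΦ]
      linarith [h.right.integral_mono hrs]
    have hp := h.left_pos ha.1 (by linarith)
    have hq := h.swap.left_pos hr (by rw [← haΦ]; linarith)
    have htail := h.tail ha.1 hr haΦ (by linarith)
    have hhead := h.head ha.1 hr haΦ
    have hsum := h.sum.integral_add 0 (t * a + (1 - t) * r) γ
    have hle := h.sum_le
    have := sub_le_of_mean_le h.lam_pos h.lam_le h.lam_le' hp hq (h.left.le a) hX hτ hu.le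
      (by linarith) hδ
    linarith [h.left.anti ha.2]
  have hγX : 0 ≤ γ * X := by positivity
  rcases le_or_gt ((∫ x in (0 : ℝ)..s, F x) - ∫ x in (0 : ℝ)..s, G x) 0 with hle | hpos
  · have : 0 ≤ γ ^ 2 * X := by positivity
    linarith
  have hsγ : s ≤ γ := by
    refine (h.right.lt_of_pos (h.swap.left_pos hs ?_)).le
    linarith
  have hcont : Continuous fun s => (∫ x in (0 : ℝ)..s, F x) - ∫ x in (0 : ℝ)..s, G x :=
    h.left.continuous_integral.sub h.right.continuous_integral
  obtain ⟨r, ⟨⟨hr0, hrs⟩, hr⟩, hmax⟩ :=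
    (isCompact_Icc.inter_right (isClosed_singleton.preimage hcont)).exists_isGreatest
      ⟨0, left_mem_Icc.2 hs, show _ - _ = (0 : ℝ) by simp⟩
  have hΔr : (∫ x in (0 : ℝ)..r, F x) - ∫ x in (0 : ℝ)..r, G x = 0 := hr
  have hafter : ∀ x ∈ Icc r s, F x - G x ≤ γ * X := by
    intro x hx
    refine pointwise x (hr0.trans hx.1) hx.2 ?_
    by_contra! hneg
    obtain ⟨y, hy, hy0⟩ := intermediate_value_Icc hx.2 hcont.continuousOn
      (show (0 : ℝ) ∈ _ from ⟨by simpa using hneg.le, hpos.le⟩)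
    have hyr := hmax ⟨⟨(hr0.trans hx.1).trans hy.1, hy.2⟩, hy0⟩
    have hxr : x = r := le_antisymm (hy.1.trans hyr) hx.1
    subst hxr
    linarith
  have hInt : ∫ x in r..s, (F x - G x) ≤ ∫ _ in r..s, γ * X :=
    intervalIntegral.integral_mono_on hrs
      ((h.left.intervalIntegrable _ _).sub (h.right.intervalIntegrable _ _))
      intervalIntegrable_const hafter
  rw [intervalIntegral.integral_sub (h.left.intervalIntegrable _ _)
    (h.right.intervalIntegrable _ _), intervalIntegral.integral_const, smul_eq_mul] at hInt
  have e1 := h.left.integral_add 0 r s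
  have e2 := h.right.integral_add 0 r s
  nlinarith

theorem abs_integral_sub_le (h : NearSaturated lam γ δ t F G H) {τ X : ℝ} (hX : 0 ≤ X)
    (hτ : 0 < τ) (hδ : 4 * δ ≤ lam ^ 3 * X ^ 2 * τ) {s : ℝ} (hs : 0 ≤ s) :
    |(∫ x in (0 : ℝ)..s, F x) - ∫ x in (0 : ℝ)..s, G x| ≤ γ ^ 2 * X + τ + 2 * δ :=
  abs_le.2 ⟨by linarith [h.swap.integral_sub_le hX hτ hδ hs], h.integral_sub_le hX hτ hδ hs⟩

theorem abs_integral_sum_sub_le (h : NearSaturated lam γ δ t F G H) {κ : ℝ}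
    (hκ : ∀ s, 0 ≤ s → |(∫ x in (0 : ℝ)..s, F x) - ∫ x in (0 : ℝ)..s, G x| ≤ κ)
    {s : ℝ} (hs : 0 ≤ s) :
    |(∫ x in (0 : ℝ)..s, H x) - ∫ x in (0 : ℝ)..s, F x| ≤ κ + 2 * δ := by
  have hδ0 := h.δ_nonneg
  have ht := h.t_pos
  have ht' := h.one_sub_t_pos
  obtain ⟨a, b, ha, hb, habs, hab⟩ := h.exists_match hs
  have hlow := h.head ha hb hab
  rw [habs] at hlow
  have hup : ∫ x in (0 : ℝ)..s, H x ≤ (∫ x in (0 : ℝ)..a, F x) + 2 * δ := by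
    rcases lt_or_ge (∫ x in (0 : ℝ)..a, F x) (1 - δ) with hu | hu
    · have htail := h.tail ha hb hab hu
      have hp := h.left_pos ha hu
      have hq := h.swap.left_pos hb (hab ▸ hu)
      have hM : 1 ≤ F a ^ t * G b ^ (1 - t) * (t / F a + (1 - t) / G b) := by
        have := Real.geom_mean_le_arith_mean2_weighted ht.le ht'.le (inv_pos.2 hp).le
          (inv_pos.2 hq).le (by ring)
        rw [Real.inv_rpow hp.le, Real.inv_rpow hq.le, ← mul_inv] at this
        have hpos : 0 < F a ^ t * G b ^ (1 - t) := by positivity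
        rw [inv_le_iff_one_le_mul₀' hpos] at this
        simpa [div_eq_mul_inv] using this
      rw [habs] at htail
      have hsum := h.sum.integral_add 0 s γ
      have hle := h.sum_le
      nlinarith
    · have := h.sum.integral_le_total s
      have := h.sum_le
      linarith
  have hκs := abs_le.1 (hκ s hs)
  rcases le_total a b with hab' | hab'
  · have h1 := h.left.integral_mono (show a ≤ s by nlinarith)
    have h2 := h.right.integral_mono (show s ≤ b by nlinarith)
    exact abs_le.2 ⟨by linarith, by linarith⟩
  · have h1 := h.left.integral_mono (show s ≤ a by nlinarith)
    have h2 := h.right.integral_mono (show b ≤ s by nlinarith)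
    exact abs_le.2 ⟨by linarith, by linarith⟩

/-- Slope bound near `0` for the profiles of a nearly saturated triple. -/
def slopeConst (lam γ : ℝ) : ℝ :=
  γ ^ 2 * (32 * γ ^ 2 / lam + (64 * γ ^ 2 / lam + 48 * γ ^ 2) / lam) + 4 * γ ^ 2

theorem le_left_of_small (h : NearSaturated lam γ δ t F G H) {s : ℝ}
    (hs : s ≤ 1 / (4 * γ)) : 1 / (4 * γ) ≤ F s := by
  have hγ := h.one_le
  have hc : 0 ≤ 1 / (4 * γ) := by positivity
  refine le_trans ?_ (h.left.anti hs)
  have h1 := h.left.tail_le hc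
  have h2 := h.left.integral_le hc
  have h3 := h.left_ge
  have h4 := h.δ_le
  have h5 : (1 / (4 * γ) - 0) * F 0 ≤ 1 / 4 := by
    calc (1 / (4 * γ) - 0) * F 0 ≤ (1 / (4 * γ) - 0) * γ := by
          gcongr
          exact h.left.le 0
      _ = 1 / 4 := by field_simp; ring
  rw [div_le_iff₀ (by positivity)]
  linarith

theorem inv_left_step (h : NearSaturated lam γ δ t F G H) {θ : ℝ} (hθ : 0 < θ)
    (hθγ : 16 * γ * θ ≤ lam) (hFG : ∀ s, 0 ≤ s → F (s + θ) ≤ G s + θ)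
    (hHF : ∀ s, 0 ≤ s → H (s + θ) ≤ F s + θ) {s s' : ℝ} (hs : 0 ≤ s)
    (hss' : s + 2 * θ = (1 - t) * s') (hs' : s' ≤ 1 / (4 * γ)) :
    (F s)⁻¹ - (F 0)⁻¹ ≤ (1 - t) * ((F s')⁻¹ - (F 0)⁻¹) + 48 * γ ^ 2 * θ := by
  have hγ := h.one_le
  have ht := h.t_pos
  have ht' := h.one_sub_t_pos
  have ht1 := h.t_lt_one
  have hl1 : lam ≤ 1 / 2 := by linarith [h.lam_le, h.lam_le']
  set c := 1 / (4 * γ) with hc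
  have hcpos : 0 < c := by positivity
  have hcγ : 4 * γ * c = 1 := by rw [hc]; field_simp
  have hθc : θ ≤ c / 2 := by
    rw [hc, div_div, le_div_iff₀ (by positivity)]; linarith
  have hs'θ : 2 * θ ≤ s' := by nlinarith
  have hs's : s ≤ s' := by nlinarith
  have hFs : c ≤ F s := h.le_left_of_small (hs's.trans hs')
  have hFs' : c ≤ F s' := h.le_left_of_small hs'
  have hF0 : 0 < F 0 := h.left_zero_pos
  have hG : F s' - θ ≤ G (s' - θ) := by
    have := hFG (s' - θ) (by linarith)
    rw [sub_add_cancel] at this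
    linarith
  have hGpos : 0 < G (s' - θ) := by linarith
  have hH : F 0 ^ t * G (s' - θ) ^ (1 - t) ≤ F s + θ := by
    refine (h.le_sum 0 (s' - θ) le_rfl (by linarith)).trans ((h.sum.anti ?_).trans (hHF s hs))
    nlinarith
  have hmean := Real.geom_mean_le_arith_mean2_weighted ht.le ht'.le (inv_pos.2 hF0).le
    (inv_pos.2 hGpos).le (by ring)
  rw [Real.inv_rpow hF0.le, Real.inv_rpow hGpos.le, ← mul_inv] at hmean
  have h1 : (F s + θ)⁻¹ ≤ t * (F 0)⁻¹ + (1 - t) * (G (s' - θ))⁻¹ :=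
    (inv_anti₀ (by positivity) hH).trans hmean
  have hc2 : 16 * γ ^ 2 * c ^ 2 = 1 := by
    calc 16 * γ ^ 2 * c ^ 2 = (4 * γ * c) ^ 2 := by ring
      _ = 1 := by rw [hcγ]; ring
  have h2 : (F s)⁻¹ ≤ (F s + θ)⁻¹ + 16 * γ ^ 2 * θ := by
    have e : (F s)⁻¹ - (F s + θ)⁻¹ = θ / (F s * (F s + θ)) := by
      have : 0 < F s := hcpos.trans_le hFs
      field_simp
      ring
    have : θ / (F s * (F s + θ)) ≤ θ / (c * c) := by
      gcongr <;> linarith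
    have e2 : θ / (c * c) = 16 * γ ^ 2 * θ := by
      rw [div_eq_iff (by positivity)]; linear_combination -θ * hc2
    linarith
  have h3 : (G (s' - θ))⁻¹ ≤ (F s')⁻¹ + 32 * γ ^ 2 * θ := by
    have hd : 0 < F s' - θ := by linarith
    have hle : (G (s' - θ))⁻¹ ≤ (F s' - θ)⁻¹ := inv_anti₀ hd hG
    have e : (F s' - θ)⁻¹ - (F s')⁻¹ = θ / ((F s' - θ) * F s') := by
      have : 0 < F s' := hcpos.trans_le hFs'
      field_simp
      ring
    have : θ / ((F s' - θ) * F s') ≤ θ / (c / 2 * c) := by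
      gcongr
      linarith
    have e2 : θ / (c / 2 * c) = 32 * γ ^ 2 * θ := by
      rw [div_eq_iff (by positivity)]; linear_combination -θ * hc2
    linarith
  have h4 : (1 - t) * (G (s' - θ))⁻¹ ≤ (1 - t) * (F s')⁻¹ + 32 * γ ^ 2 * θ := by
    have : 0 ≤ 32 * γ ^ 2 * θ := by positivity
    nlinarith
  linarith

theorem inv_left_sub_le (h : NearSaturated lam γ δ t F G H) {θ : ℝ} (hθ : 0 < θ)
    (hθγ : 16 * γ * θ ≤ lam) (hFG : ∀ s, 0 ≤ s → F (s + θ) ≤ G s + θ)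
    (hHF : ∀ s, 0 ≤ s → H (s + θ) ≤ F s + θ) {s : ℝ} (hs : s ∈ Icc 0 (1 / (4 * γ))) :
    (F s)⁻¹ - (F 0)⁻¹ ≤
      32 * γ ^ 2 / lam * s + (64 * γ ^ 2 / lam + 48 * γ ^ 2) / lam * θ := by
  have hγ := h.one_le
  have ht := h.t_pos
  have ht' := h.one_sub_t_pos
  have hl := h.lam_pos
  set K := 32 * γ ^ 2 / lam with hK
  have hKpos : 0 < K := by positivity
  set B := (64 * γ ^ 2 / lam + 48 * γ ^ 2) / lam * θ with hB
  have hBpos : 0 < B := by positivity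
  have hlB : lam * B = 2 * K * θ + 48 * γ ^ 2 * θ := by
    rw [hB, hK]; field_simp; ring
  have hF0 : 0 < F 0 := h.left_zero_pos
  have hinv : ∀ r ∈ Icc 0 (1 / (4 * γ)), (F r)⁻¹ - (F 0)⁻¹ ≤ 4 * γ := by
    intro r hr
    have h1 := inv_anti₀ (by positivity) (h.le_left_of_small hr.2)
    rw [one_div, inv_inv] at h1
    have := inv_pos.2 hF0
    linarith
  have hbdd : BddAbove ((fun r => (F r)⁻¹ - (F 0)⁻¹ - K * r) '' Icc 0 (1 / (4 * γ))) := by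
    refine ⟨4 * γ, ?_⟩
    rintro _ ⟨r, hr, rfl⟩
    have := hinv r hr
    have := mul_nonneg hKpos.le hr.1
    simp only
    linarith
  set S := sSup ((fun r => (F r)⁻¹ - (F 0)⁻¹ - K * r) '' Icc 0 (1 / (4 * γ))) with hS
  have hleS : ∀ r ∈ Icc 0 (1 / (4 * γ)), (F r)⁻¹ - (F 0)⁻¹ - K * r ≤ S := fun r hr =>
    le_csSup hbdd ⟨r, hr, rfl⟩
  have hSle : S ≤ max B ((1 - t) * S + t * B) := by
    refine csSup_le ⟨_, s, hs, rfl⟩ ?_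
    rintro _ ⟨r, hr, rfl⟩
    simp only
    set r' := (r + 2 * θ) / (1 - t) with hr'
    have hrr' : r + 2 * θ = (1 - t) * r' := by rw [hr', mul_div_cancel₀ _ ht'.ne']
    rcases le_or_gt r' (1 / (4 * γ)) with hle | hgt
    · refine le_max_of_le_right ?_
      have hr'0 : 0 ≤ r' := by have := hr.1; positivity
      have h1 := h.inv_left_step hθ hθγ hFG hHF hr.1 hrr' hle
      have h2 := mul_le_mul_of_nonneg_left (hleS r' ⟨hr'0, hle⟩) ht'.le
      have h3 := mul_le_mul_of_nonneg_right h.lam_le hBpos.le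
      have h4 : (1 - t) * (K * r') = K * r + 2 * K * θ := by
        linear_combination -K * hrr'
      linarith
    · refine le_max_of_le_left ?_
      have h1 := hinv r hr
      have h2 : lam * (1 / (4 * γ)) ≤ (1 - t) * r' :=
        mul_le_mul h.lam_le' hgt.le (by positivity) ht'.le
      have h3 : θ ≤ lam * (1 / (4 * γ)) / 4 := by
        rw [mul_one_div, div_div, le_div_iff₀ (by positivity)]; linarith
      have h4 : lam * (1 / (4 * γ)) / 2 ≤ r := by linarith
      have h5 : 4 * γ ≤ K * r := by
        calc 4 * γ = K * (lam * (1 / (4 * γ)) / 2) := by rw [hK]; field_simp; norm_num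
          _ ≤ K * r := by gcongr
      linarith
  have hSB : S ≤ B := by
    rcases le_max_iff.1 hSle with h1 | h1
    · exact h1
    · exact le_of_mul_le_mul_left (by linarith) ht
  linarith [hleS s hs]

theorem left_zero_sub_le (h : NearSaturated lam γ δ t F G H) {θ : ℝ} (hθ : 0 < θ)
    (hθγ : 16 * γ * θ ≤ lam) (hFG : ∀ s, 0 ≤ s → F (s + θ) ≤ G s + θ)
    (hHF : ∀ s, 0 ≤ s → H (s + θ) ≤ F s + θ) {s : ℝ} (hs : 0 ≤ s) :
    F 0 - F s ≤ slopeConst lam γ * (s + θ) := by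
  have hγ := h.one_le
  have hl := h.lam_pos
  rw [slopeConst]
  set K := 32 * γ ^ 2 / lam with hK
  have hKpos : 0 < K := by positivity
  set B := (64 * γ ^ 2 / lam + 48 * γ ^ 2) / lam with hB
  have hBpos : 0 < B := by positivity
  rcases le_or_gt s (1 / (4 * γ)) with hle | hgt
  · have h1 := h.inv_left_sub_le hθ hθγ hFG hHF ⟨hs, hle⟩
    have hF0 : 0 < F 0 := h.left_zero_pos
    have hFs : 0 < F s := lt_of_lt_of_le (by positivity) (h.le_left_of_small hle)
    have hE : 0 ≤ K * s + B * θ := by positivity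
    calc F 0 - F s = F 0 * F s * ((F s)⁻¹ - (F 0)⁻¹) := by field_simp
      _ ≤ F 0 * F s * (K * s + B * θ) := by gcongr
      _ ≤ γ * γ * (K * s + B * θ) := by
          gcongr
          · exact h.left.le 0
          · exact h.left.le s
      _ ≤ _ := by
          have : 0 ≤ γ ^ 2 * (K * θ + B * s) + 4 * γ ^ 2 * (s + θ) := by positivity
          linarith
  · have h1 : γ ≤ 4 * γ ^ 2 * s := by
      calc γ = 4 * γ ^ 2 * (1 / (4 * γ)) := by field_simp
        _ ≤ _ := by gcongr
    have h2 := h.left.le 0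
    have h3 := h.left.nonneg s
    have : 0 ≤ γ ^ 2 * (K + B) * (s + θ) + 4 * γ ^ 2 * θ := by positivity
    linarith

theorem left_close (h : NearSaturated lam γ δ t F G H) {τ X θ : ℝ} (hX : 0 ≤ X) (hτ : 0 < τ)
    (hδ : 4 * δ ≤ lam ^ 3 * X ^ 2 * τ) (hθ : 0 < θ) (hθγ : 16 * γ * θ ≤ lam)
    (hθκ : 2 * (γ ^ 2 * X + τ + 4 * δ) ≤ θ ^ 2) :
    (∀ s, 0 ≤ s → F (s + θ) ≤ G s + θ) ∧
      ∀ s, 0 ≤ s → F 0 - F s ≤ slopeConst lam γ * (s + θ) := by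
  have hδ0 := h.δ_nonneg
  have hκ := fun s (hs : 0 ≤ s) => h.abs_integral_sub_le hX hτ hδ hs
  have hFG : ∀ s, 0 ≤ s → F (s + θ) ≤ G s + θ := fun s hs =>
    h.left.add_le_of_integral_close h.right hθ (by linarith) hκ hs
  have hHF : ∀ s, 0 ≤ s → H (s + θ) ≤ F s + θ := fun s hs =>
    h.sum.add_le_of_integral_close h.left hθ (by linarith)
      (fun s hs => h.abs_integral_sum_sub_le hκ hs) hs
  exact ⟨hFG, fun s hs => h.left_zero_sub_le hθ hθγ hFG hHF hs⟩

end NearSaturated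

theorem measurableSet_levelSet {n : ℕ} {A : Set (Sp n)} (hA : MeasurableSet A) (s : ℝ) :
    MeasurableSet (levelSet A s) :=
  measurableSet_lt measurable_const (measurable_measure_prodMk_left hA)

theorem antitone_levelSet {n : ℕ} (A : Set (Sp n)) : Antitone (levelSet A) :=
  fun _ _ h _ hx => (ENNReal.ofReal_le_ofReal h).trans_lt hx

theorem levelSet_of_nonpos {n : ℕ} (A : Set (Sp n)) {s : ℝ} (hs : s ≤ 0) :
    levelSet A s = levelSet A 0 := by
  simp only [levelSet, ENNReal.ofReal_of_nonpos hs, ENNReal.ofReal_zero]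

theorem levelSet_subset_image_fst {n : ℕ} (A : Set (Sp n)) (s : ℝ) :
    levelSet A s ⊆ Prod.fst '' A := by
  intro x hx
  obtain ⟨y, hy⟩ := nonempty_of_measure_ne_zero (pos_of_gt hx).ne'
  exact ⟨(x, y), hy, rfl⟩

theorem volume_eq_lintegral_vslice {n : ℕ} {A : Set (Sp n)} (hA : MeasurableSet A) :
    volume A = ∫⁻ x, volume (vslice A x) := by
  rw [Measure.volume_eq_prod, Measure.prod_apply hA]
  rfl

theorem setLIntegral_volume_levelSet {n : ℕ} {E : Set (Sp n)} (hE : MeasurableSet E) (γ : ℝ) :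
    ∫⁻ s in Ioo 0 γ, volume (levelSet E s) =
      ∫⁻ x, min (volume (vslice E x)) (ENNReal.ofReal γ) := by
  have hm : Measurable fun x => min (volume (vslice E x)) (ENNReal.ofReal γ) :=
    (measurable_measure_prodMk_left hE).min measurable_const
  have hfin : ∀ x, min (volume (vslice E x)) (ENNReal.ofReal γ) ≠ ∞ := fun x =>
    ((min_le_right _ _).trans_lt ENNReal.ofReal_lt_top).ne
  have h := lintegral_eq_lintegral_meas_lt volume
    (f := fun x => (min (volume (vslice E x)) (ENNReal.ofReal γ)).toReal)
    (Eventually.of_forall fun x => ENNReal.toReal_nonneg) hm.ennreal_toReal.aemeasurable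
  simp only [ENNReal.ofReal_toReal (hfin _)] at h
  rw [h, ← lintegral_indicator measurableSet_Ioo, ← lintegral_indicator measurableSet_Ioi]
  congr 1 with s
  by_cases hs : 0 < s
  · rw [indicator_of_mem (show s ∈ Ioi 0 from hs)]
    have hset : {x | s < (min (volume (vslice E x)) (ENNReal.ofReal γ)).toReal} =
        {x | ENNReal.ofReal s < volume (vslice E x) ∧ s < γ} := by
      ext x
      rw [mem_ofPred_eq, mem_ofPred_eq, ← ENNReal.ofReal_lt_iff_lt_toReal hs.le (hfin x), lt_min_iff,
        ENNReal.ofReal_lt_ofReal_iff_of_nonneg hs.le]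
    rw [hset]
    by_cases hsγ : s < γ
    · rw [indicator_of_mem (show s ∈ Ioo 0 γ from ⟨hs, hsγ⟩)]
      simp [hsγ, levelSet]
    · rw [indicator_of_notMem fun h => hsγ h.2]
      simp [hsγ]
  · rw [indicator_of_notMem fun h => hs h.1, indicator_of_notMem (show s ∉ Ioi 0 from hs)]

theorem IsProfile.ofReal_integral {γ : ℝ} {F : ℝ → ℝ} (hF : IsProfile γ F) (hγ : 0 ≤ γ) :
    ENNReal.ofReal (∫ x in (0 : ℝ)..γ, F x) = ∫⁻ s in Ioo 0 γ, ENNReal.ofReal (F s) := by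
  rw [intervalIntegral.integral_of_le hγ, integral_Ioc_eq_integral_Ioo,
    ofReal_integral_eq_lintegral_ofReal]
  · exact (hF.intervalIntegrable 0 γ).1.mono_set Ioo_subset_Ioc_self
  · exact Eventually.of_forall hF.nonneg

namespace IsNormalized

variable {n : ℕ} {γ : ℝ} {A : Set (Sp n)}

theorem volume_vslice_le (h : IsNormalized γ A) (x : Edim n) :
    volume (vslice A x) ≤ ENNReal.ofReal γ :=
  (le_iSup (fun x => volume (vslice A x)) x).trans h.2.1

theorem volume_levelSet_le (h : IsNormalized γ A) (s : ℝ) :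
    volume (levelSet A s) ≤ ENNReal.ofReal γ :=
  (measure_mono (levelSet_subset_image_fst A s)).trans h.2.2

theorem volume_levelSet_ne_top (h : IsNormalized γ A) (s : ℝ) : volume (levelSet A s) ≠ ∞ :=
  ((h.volume_levelSet_le s).trans_lt ENNReal.ofReal_lt_top).ne

theorem isProfile (h : IsNormalized γ A) (hγ : 0 ≤ γ) :
    IsProfile γ fun s => volume.real (levelSet A s) where
  anti _ _ hs := measureReal_mono (antitone_levelSet A hs) (h.volume_levelSet_ne_top _)
  nonneg _ := measureReal_nonneg
  le s := ENNReal.toReal_le_of_le_ofReal hγ (h.volume_levelSet_le s)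
  eq_zero s hs := by
    have : levelSet A s = ∅ := by
      refine eq_empty_of_forall_notMem fun x hx => ?_
      exact (h.volume_vslice_le x).not_gt ((ENNReal.ofReal_le_ofReal hs).trans_lt hx)
    simp [this]

theorem integral_volume_levelSet (h : IsNormalized γ A) (hγ : 0 ≤ γ) (hA : MeasurableSet A) :
    ∫ s in (0 : ℝ)..γ, volume.real (levelSet A s) = (volume A).toReal := by
  have hp := h.isProfile hγ
  rw [← ENNReal.toReal_ofReal (hp.integral_nonneg hγ), hp.ofReal_integral hγ]
  congr 1
  simp only [ofReal_measureReal (h.volume_levelSet_ne_top _)]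
  rw [setLIntegral_volume_levelSet hA, volume_eq_lintegral_vslice hA]
  simp only [min_eq_left (h.volume_vslice_le _)]

theorem volume_diff_le (h : IsNormalized γ A) (hA : MeasurableSet A) {η : ℝ} (hη : 0 ≤ η) :
    volume (A \ Prod.fst ⁻¹' levelSet A η) ≤
      ENNReal.ofReal (η * (volume.real (levelSet A 0) - volume.real (levelSet A η))) := by
  have hm := measurableSet_levelSet hA
  have hsub : levelSet A η ⊆ levelSet A 0 := antitone_levelSet A hη
  rw [← measureReal_sdiff hsub (hm η) (h.volume_levelSet_ne_top 0), ENNReal.ofReal_mul hη,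
    ofReal_measureReal (measure_ne_top_of_subset sdiff_subset (h.volume_levelSet_ne_top 0)),
    ← lintegral_indicator_const ((hm 0).diff (hm η)),
    volume_eq_lintegral_vslice (hA.diff (measurable_fst (hm η)))]
  refine lintegral_mono fun x => ?_
  by_cases hx : x ∈ levelSet A η
  · have : vslice (A \ Prod.fst ⁻¹' levelSet A η) x = ∅ :=
      eq_empty_of_forall_notMem fun y hy => hy.2 hx
    simp [this]
  · have hle : volume (vslice (A \ Prod.fst ⁻¹' levelSet A η) x) ≤ volume (vslice A x) :=
      measure_mono fun y hy => hy.1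
    by_cases hx0 : x ∈ levelSet A 0
    · rw [indicator_of_mem (show x ∈ levelSet A 0 \ levelSet A η from ⟨hx0, hx⟩)]
      exact hle.trans (not_lt.1 hx)
    · refine hle.trans ?_
      have : volume (vslice A x) = 0 := by simpa [levelSet] using hx0
      simp [this]

end IsNormalized

theorem levelSet_add_subset {n : ℕ} {A B Z : Set (Sp n)} {t : ℝ} (ht : 0 < t) (ht1 : t < 1)
    (hA : MeasurableSet A) (hB : MeasurableSet B) (hZ : t • A + (1 - t) • B ⊆ Z) {s s' : ℝ}
    (hs : 0 ≤ s) (hs' : 0 ≤ s') :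
    t • levelSet A s + (1 - t) • levelSet B s' ⊆ levelSet Z (t * s + (1 - t) * s') := by
  rintro _ ⟨_, ⟨x, hx, rfl⟩, _, ⟨y, hy, rfl⟩, rfl⟩
  have hsub : t • vslice A x + (1 - t) • vslice B y ⊆ vslice Z (t • x + (1 - t) • y) := by
    rintro _ ⟨_, ⟨u, hu, rfl⟩, _, ⟨v, hv, rfl⟩, rfl⟩
    exact hZ ⟨_, smul_mem_smul_set hu, _, smul_mem_smul_set hv, rfl⟩
  have ht' : 0 < 1 - t := sub_pos.2 ht1
  calc ENNReal.ofReal (t * s + (1 - t) * s')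
      = ENNReal.ofReal t * ENNReal.ofReal s + ENNReal.ofReal (1 - t) * ENNReal.ofReal s' := by
        rw [ENNReal.ofReal_add (by positivity) (by positivity), ENNReal.ofReal_mul ht.le,
          ENNReal.ofReal_mul ht'.le]
    _ < ENNReal.ofReal t * volume (vslice A x) + ENNReal.ofReal (1 - t) * volume (vslice B y) := by
        refine ENNReal.add_lt_add ?_ ?_
        · exact ENNReal.mul_lt_mul_right (by simpa using ht) ENNReal.ofReal_ne_top hx
        · exact ENNReal.mul_lt_mul_right (by simpa using ht1) ENNReal.ofReal_ne_top hy
    _ ≤ volume (t • vslice A x + (1 - t) • vslice B y) :=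
        ofReal_mul_volume_add_le ht ht1 (measurable_prodMk_left hA) (measurable_prodMk_left hB)
          (nonempty_of_measure_ne_zero (pos_of_gt hx).ne')
          (nonempty_of_measure_ne_zero (pos_of_gt hy).ne')
    _ ≤ _ := measure_mono hsub

theorem rpow_mul_rpow_volume_levelSet_le {n : ℕ} {A B Z : Set (Sp n)} {t γ : ℝ} (ht : 0 < t)
    (ht1 : t < 1) (hγ : 0 < γ) (hA : MeasurableSet A) (hB : MeasurableSet B)
    (hAn : IsNormalized γ A) (hBn : IsNormalized γ B)
    (hZ : t • A + (1 - t) • B ⊆ Z) {s s' : ℝ} (hs : 0 ≤ s) (hs' : 0 ≤ s') :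
    volume.real (levelSet A s) ^ t * volume.real (levelSet B s') ^ (1 - t) ≤
      (min (volume (levelSet Z (t * s + (1 - t) * s'))) (ENNReal.ofReal γ)).toReal := by
  have ht' : 0 < 1 - t := sub_pos.2 ht1
  have hle : volume.real (levelSet A s) ^ t * volume.real (levelSet B s') ^ (1 - t) ≤ γ := by
    calc _ ≤ γ ^ t * γ ^ (1 - t) := by
          have h1 := (hAn.isProfile hγ.le).le s
          have h2 := (hBn.isProfile hγ.le).le s'
          gcongr
      _ = γ := by rw [← Real.rpow_add hγ]; simp
  rcases le_total (ENNReal.ofReal γ) (volume (levelSet Z (t * s + (1 - t) * s'))) with h | h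
  · rwa [min_eq_right h, ENNReal.toReal_ofReal hγ.le]
  · rw [min_eq_left h]
    exact brunnMinkowski_euclidean ht ht1 (measurableSet_levelSet hA s)
      (measurableSet_levelSet hB s') (hAn.volume_levelSet_ne_top s) (hBn.volume_levelSet_ne_top s')
      (h.trans_lt ENNReal.ofReal_lt_top).ne (levelSet_add_subset ht ht1 hA hB hZ hs hs')

theorem exists_nearSaturated_levelSet {n : ℕ} {A B : Set (Sp n)} {lam γ δ t : ℝ} (hl : 0 < lam)
    (hlt : lam ≤ t) (hlt' : lam ≤ 1 - t) (hγ : 1 ≤ γ) (hδ : 0 ≤ δ) (hδ' : δ ≤ 1 / 2)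
    (hA : MeasurableSet A) (hB : MeasurableSet B) (hAn : IsNormalized γ A)
    (hBn : IsNormalized γ B) (hA1 : |(volume A).toReal - 1| ≤ δ)
    (hB1 : |(volume B).toReal - 1| ≤ δ)
    (hsum : volume (t • A + (1 - t) • B) ≤ ENNReal.ofReal (1 + δ)) :
    ∃ H, NearSaturated lam γ δ t (fun s => volume.real (levelSet A s))
      (fun s => volume.real (levelSet B s)) H := by
  have hγ0 : 0 < γ := one_pos.trans_le hγ
  have ht : 0 < t := hl.trans_le hlt
  have ht' : 0 < 1 - t := hl.trans_le hlt'
  set Z := toMeasurable volume (t • A + (1 - t) • B)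
  have hZm : MeasurableSet Z := measurableSet_toMeasurable _ _
  have hfin : ∀ s, min (volume (levelSet Z s)) (ENNReal.ofReal γ) ≠ ∞ := fun s =>
    ((min_le_right _ _).trans_lt ENNReal.ofReal_lt_top).ne
  set H : ℝ → ℝ := fun s =>
    if s < γ then (min (volume (levelSet Z s)) (ENNReal.ofReal γ)).toReal else 0
  have hH : IsProfile γ H := by
    refine ⟨fun s s' hss' => ?_, fun s => ?_, fun s => ?_, fun s hs => if_neg hs.not_gt⟩
    · simp only [H]
      split_ifs with h1 h2 h2
      · refine ENNReal.toReal_mono (hfin s) ?_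
        gcongr
        exact antitone_levelSet Z hss'
      · exact absurd (hss'.trans_lt h1) h2
      · exact ENNReal.toReal_nonneg
      · exact le_rfl
    · simp only [H]
      split_ifs
      · exact ENNReal.toReal_nonneg
      · exact le_rfl
    · simp only [H]
      split_ifs
      · exact ENNReal.toReal_le_of_le_ofReal hγ0.le (min_le_right _ _)
      · exact hγ0.le
  have hA1 := abs_le.1 hA1
  have hB1 := abs_le.1 hB1
  rw [← hAn.integral_volume_levelSet hγ0.le hA] at hA1
  rw [← hBn.integral_volume_levelSet hγ0.le hB] at hB1
  refine ⟨H, hl, hlt, hlt', hγ, hAn.isProfile hγ0.le, hBn.isProfile hγ0.le, hH, ?_, hδ, hδ',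
    by linarith, by linarith, by linarith, by linarith, ?_⟩
  · intro s s' hs hs'
    by_cases hsγ : s < γ
    · by_cases hsγ' : s' < γ
      · have hlt : t * s + (1 - t) * s' < γ := by
          have h1 := mul_lt_mul_of_pos_left hsγ ht
          have h2 := mul_lt_mul_of_pos_left hsγ' ht'
          linarith
        simp only [H, if_pos hlt]
        exact rpow_mul_rpow_volume_levelSet_le ht (sub_pos.1 ht') hγ0 hA hB hAn hBn
          (subset_toMeasurable _ _) hs hs'
      · simp only [(hBn.isProfile hγ0.le).eq_zero s' (not_lt.1 hsγ'), Real.zero_rpow ht'.ne',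
          mul_zero]
        exact hH.nonneg _
    · simp only [(hAn.isProfile hγ0.le).eq_zero s (not_lt.1 hsγ), Real.zero_rpow ht.ne', zero_mul]
      exact hH.nonneg _
  · rw [← ENNReal.ofReal_le_ofReal_iff (by linarith), hH.ofReal_integral hγ0.le]
    refine le_trans ?_ ((measure_toMeasurable _).trans_le hsum)
    calc ∫⁻ s in Ioo 0 γ, ENNReal.ofReal (H s)
        ≤ ∫⁻ s in Ioo 0 γ, volume (levelSet Z s) := by
          refine lintegral_mono fun s => ?_
          simp only [H]
          split_ifs
          · rw [ENNReal.ofReal_toReal (hfin s)]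
            exact min_le_left _ _
          · simp
      _ = ∫⁻ x, min (volume (vslice Z x)) (ENNReal.ofReal γ) := setLIntegral_volume_levelSet hZm γ
      _ ≤ ∫⁻ x, volume (vslice Z x) := lintegral_mono fun x => min_le_left _ _
      _ = volume Z := (volume_eq_lintegral_vslice hZm).symm

/-- The tolerance for which the profiles of nearly extremal sets are compared. -/
def closeness (lam γ δ : ℝ) : ℝ :=
  √(2 * (γ ^ 2 * √(4 * √δ / lam ^ 3) + √δ + 4 * δ))

theorem closeness_pos {lam γ δ : ℝ} (hδ : 0 < δ) : 0 < closeness lam γ δ := by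
  rw [closeness]; positivity

theorem tendsto_closeness (lam γ : ℝ) :
    Tendsto (closeness lam γ) (nhdsWithin 0 (Ioi 0)) (nhds 0) := by
  have hc : Continuous (closeness lam γ) := by unfold closeness; fun_prop
  have := hc.tendsto 0
  rw [show closeness lam γ 0 = 0 by simp [closeness]] at this
  exact this.mono_left nhdsWithin_le_nhds

theorem NearSaturated.left_close_closeness {lam γ δ t : ℝ} {F G H : ℝ → ℝ}
    (h : NearSaturated lam γ δ t F G H) (hδ : 0 < δ) (hθ : 16 * γ * closeness lam γ δ ≤ lam) :
    (∀ s, 0 ≤ s → F (s + closeness lam γ δ) ≤ G s + closeness lam γ δ) ∧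
      ∀ s, 0 ≤ s → F 0 - F s ≤ slopeConst lam γ * (s + closeness lam γ δ) := by
  have hl := h.lam_pos
  refine h.left_close (X := √(4 * √δ / lam ^ 3)) (τ := √δ) (Real.sqrt_nonneg _)
    (Real.sqrt_pos.2 hδ) ?_ (closeness_pos hδ) hθ ?_
  · rw [Real.sq_sqrt (by positivity), mul_div_cancel₀ _ (by positivity), mul_assoc,
      Real.mul_self_sqrt hδ.le]
  · rw [closeness, Real.sq_sqrt (by positivity)]

theorem level_set_bounds_of_close {n : ℕ} {A B : Set (Sp n)} {γ θ K : ℝ} (hγ : 0 ≤ γ)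
    (hθ : 0 ≤ θ) (hK : 0 ≤ K) (hA : MeasurableSet A) (hAn : IsNormalized γ A)
    (hBn : IsNormalized γ B)
    (hclose : ∀ s, 0 ≤ s →
      volume.real (levelSet A (s + θ)) ≤ volume.real (levelSet B s) + θ)
    (hslope : ∀ s, 0 ≤ s →
      volume.real (levelSet A 0) - volume.real (levelSet A s) ≤ K * (s + θ)) :
    (∀ η, (2 * K + 1) * θ ≤ η →
      volume (A \ Prod.fst ⁻¹' levelSet A η) ≤ ENNReal.ofReal (2 * K * η ^ 2)) ∧
    ∀ s, 0 < s → volume (levelSet A s) ≤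
      volume (levelSet B (s - (2 * K + 1) * θ)) + ENNReal.ofReal ((2 * K + 1) * θ) := by
  have hanti := (hAn.isProfile hγ).anti
  have hKθ : 0 ≤ K * θ := by positivity
  refine ⟨fun η hη => ?_, fun s hs => ?_⟩
  · have hθη : θ ≤ η := by linarith
    have hη0 : 0 ≤ η := hθ.trans hθη
    refine (hAn.volume_diff_le hA hη0).trans (ENNReal.ofReal_le_ofReal ?_)
    calc _ ≤ η * (K * (η + θ)) := by gcongr; exact hslope η hη0
      _ ≤ η * (K * (η + η)) := by gcongr
      _ = 2 * K * η ^ 2 := by ring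
  · have key : volume.real (levelSet A s) ≤
        volume.real (levelSet B (s - (2 * K + 1) * θ)) + (2 * K + 1) * θ := by
      rcases le_total ((2 * K + 1) * θ) s with hle | hle
      · have h1 := hclose (s - (2 * K + 1) * θ) (by linarith)
        have h2 := hanti (show s - (2 * K + 1) * θ + θ ≤ s by linarith)
        simp only at h2
        linarith
      · rw [levelSet_of_nonpos B (sub_nonpos.2 hle)]
        have h1 := hclose 0 le_rfl
        have h2 := hslope θ hθ
        have h3 := hanti hs.le
        rw [zero_add] at h1
        simp only at h3
        linarith
    rw [← ofReal_measureReal (hAn.volume_levelSet_ne_top s),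
      ← ofReal_measureReal (hBn.volume_levelSet_ne_top (s - (2 * K + 1) * θ)),
      ← ENNReal.ofReal_add measureReal_nonneg (by positivity)]
    exact ENNReal.ofReal_le_ofReal key

theorem exists_pos_le_of_isCompact_subset_Ioo {Λ : Set ℝ} (hc : IsCompact Λ)
    (h : Λ ⊆ Ioo (0 : ℝ) 1) : ∃ lam, 0 < lam ∧ ∀ t ∈ Λ, lam ≤ t ∧ lam ≤ 1 - t := by
  rcases Λ.eq_empty_or_nonempty with rfl | hne
  · exact ⟨1, one_pos, by simp⟩
  · obtain ⟨a, haΛ, ha⟩ := hc.exists_isLeast hne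
    obtain ⟨b, hbΛ, hb⟩ := hc.exists_isGreatest hne
    refine ⟨min a (1 - b), lt_min (h haΛ).1 (sub_pos.2 (h hbΛ).2), fun t ht => ⟨?_, ?_⟩⟩
    · exact (min_le_left _ _).trans (ha ht)
    · exact (min_le_right _ _).trans (sub_le_sub_left (hb ht) 1)

/-- Lemma 5.1: there are `C < ∞` and `ε(δ) → 0` such that for all sufficiently small `δ > 0`,
all `t ∈ Λ`, and all normalized Borel `A, B` with `||A|-1| < δ`, `||B|-1| < δ`,
`|tA+(1-t)B| < 1+δ`: (i) `|A \ π⁻¹(𝒜(η))| ≤ Cη²` and `|B \ π⁻¹(ℬ(η))| ≤ Cη²` for all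
`η ≥ ε(δ)`; and (ii) `|𝒜(s)| ≤ |ℬ(s-ε(δ))| + ε(δ)` and `|ℬ(s)| ≤ |𝒜(s-ε(δ))| + ε(δ)`
for all `s > 0`. -/
theorem near_extremizer_level_set_bounds
    (d : ℕ) (hd : 2 ≤ d) (Λ : Set ℝ) (hΛc : IsCompact Λ) (hΛ : Λ ⊆ Set.Ioo (0:ℝ) 1)
    (γ : ℝ) (hγ : 1 ≤ γ) :
    ∃ (C : ℝ) (ε : ℝ → ℝ) (δ₀ : ℝ), 0 < δ₀ ∧ (∀ δ, 0 < δ → 0 < ε δ) ∧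
      Filter.Tendsto ε (nhdsWithin 0 (Set.Ioi 0)) (nhds 0) ∧
      ∀ δ : ℝ, 0 < δ → δ < δ₀ → ∀ t ∈ Λ, ∀ A B : Set (Sp (d-1)),
        MeasurableSet A → MeasurableSet B →
        IsNormalized γ A → IsNormalized γ B →
        |(volume A).toReal - 1| < δ → |(volume B).toReal - 1| < δ →
        volume (t • A + (1-t) • B) < ENNReal.ofReal (1 + δ) →
        (∀ η : ℝ, ε δ ≤ η →
          volume (A \ Prod.fst ⁻¹' (levelSet A η)) ≤ ENNReal.ofReal (C * η^2) ∧
          volume (B \ Prod.fst ⁻¹' (levelSet B η)) ≤ ENNReal.ofReal (C * η^2)) ∧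
        (∀ s : ℝ, 0 < s →
          volume (levelSet A s) ≤ volume (levelSet B (s - ε δ)) + ENNReal.ofReal (ε δ) ∧
          volume (levelSet B s) ≤ volume (levelSet A (s - ε δ)) + ENNReal.ofReal (ε δ)) := by
  have hγ0 : 0 < γ := one_pos.trans_le hγ
  obtain ⟨lam, hl, hlam⟩ := exists_pos_le_of_isCompact_subset_Ioo hΛc hΛ
  have hK : 0 ≤ NearSaturated.slopeConst lam γ := by rw [NearSaturated.slopeConst]; positivity
  have hlim := tendsto_closeness lam γ
  have hev : ∀ᶠ δ in nhdsWithin (0 : ℝ) (Ioi 0), 16 * γ * closeness lam γ δ ≤ lam := by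
    have := hlim.const_mul (16 * γ)
    rw [mul_zero] at this
    exact (this.eventually_lt_const hl).mono fun _ => le_of_lt
  obtain ⟨δ₁, hδ₁, hsmall⟩ := mem_nhdsGT_iff_exists_Ioo_subset.1 hev
  refine ⟨2 * NearSaturated.slopeConst lam γ,
    fun δ => (2 * NearSaturated.slopeConst lam γ + 1) * closeness lam γ δ,
    min δ₁ (1 / 2), lt_min hδ₁ (by norm_num),
    fun δ hδ => mul_pos (by linarith) (closeness_pos hδ), ?_, ?_⟩
  · simpa using hlim.const_mul (2 * NearSaturated.slopeConst lam γ + 1)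
  intro δ hδ hδlt t ht A B hA hB hAn hBn hA1 hB1 hsum
  have hθ : 16 * γ * closeness lam γ δ ≤ lam := hsmall ⟨hδ, hδlt.trans_le (min_le_left _ _)⟩
  obtain ⟨H, hsat⟩ := exists_nearSaturated_levelSet hl (hlam t ht).1 (hlam t ht).2 hγ hδ.le
    (hδlt.le.trans (min_le_right _ _)) hA hB hAn hBn hA1.le hB1.le hsum.le
  obtain ⟨hAB, hA0⟩ := hsat.left_close_closeness hδ hθ
  obtain ⟨hBA, hB0⟩ := hsat.swap.left_close_closeness hδ hθ
  have hpos := (closeness_pos (lam := lam) (γ := γ) hδ).le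
  obtain ⟨hAi, hAii⟩ := level_set_bounds_of_close hγ0.le hpos hK hA hAn hBn hAB hA0
  obtain ⟨hBi, hBii⟩ := level_set_bounds_of_close hγ0.le hpos hK hB hBn hAn hBA hB0
  exact ⟨fun η hη => ⟨hAi η hη, hBi η hη⟩, fun s hs => ⟨hAii s hs, hBii s hs⟩⟩
end
end

section
/- Let U, V ⊆ ℝ be nonempty Borel sets with finite Lebesgue measures, and let ε > 0 satisfy ε < min(|U|, |V|). If the outer Lebesgue measure of the sumset satisfies |U + V| < |U| + |V| + ε, then there exists an interval I ⊆ ℝ such that U ⊆ I and |I| < |U| + ε (equivalently, |I ∖ U| < ε). -/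
open MeasureTheory Set Pointwise Filter ENNReal

noncomputable section

/-- A prime-modulus form of the Freiman theorem on small sumsets of integers: if `A` contains
`0` and `p`, then `A + B` is large in terms of the residues of `A` modulo `p` and of `B`. -/
theorem card_add_of_zero_mem_of_prime_mem {p : ℕ} [Fact p.Prime] {A B : Finset ℤ}
    (h0 : 0 ∈ A) (hp : (p : ℤ) ∈ A) (hB : B.Nonempty) :
    p + B.card ≤ (A + B).card ∨
      (A.image (Int.cast : ℤ → ZMod p)).card + 2 * B.card ≤ (A + B).card + 1 ∨
      2 * (A.image (Int.cast : ℤ → ZMod p)).card + B.card ≤ (A + B).card + 2 := by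
  classical
  set π : ℤ → ZMod p := Int.cast with hπ
  set A' := A.image π
  set f : Finset ℤ → ZMod p → ℕ := fun T x => (T.filter (fun t => π t = x)).card with hf
  have hsum : ∀ T : Finset ℤ, T.card = ∑ x, f T x := fun T =>
    Finset.card_eq_sum_card_fiberwise (fun _ _ => Finset.mem_univ _)
  set B₁ := Finset.univ.filter (fun x => 1 ≤ f B x) with hB₁
  set B₂ := Finset.univ.filter (fun x => 2 ≤ f B x) with hB₂
  have hcard : ∀ T : Finset (ZMod p), T.card = ∑ x, if x ∈ T then 1 else 0 := fun T => by simp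
  have hle : ∀ x, f B x ≤ f (A + B) x := fun x => by
    apply Finset.card_le_card
    apply Finset.filter_subset_filter
    intro b hb
    simpa using Finset.add_mem_add h0 hb
  have hsucc : ∀ x, 1 ≤ f B x → f B x + 1 ≤ f (A + B) x := fun x hx => by
    set F := B.filter (fun t => π t = x) with hF
    have hne : F.Nonempty := Finset.card_pos.mp hx
    have hmax := Finset.mem_filter.mp (F.max'_mem hne)
    have hnot : (p : ℤ) + F.max' hne ∉ F := fun h => by
      have := F.le_max' _ h
      have := (Fact.out : p.Prime).pos
      omega
    calc f B x + 1 = (insert ((p : ℤ) + F.max' hne) F).card :=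
          (Finset.card_insert_of_notMem hnot).symm
      _ ≤ f (A + B) x := by
        apply Finset.card_le_card
        intro y hy
        rcases Finset.mem_insert.mp hy with rfl | hy
        · refine Finset.mem_filter.mpr ⟨Finset.add_mem_add hp hmax.1, ?_⟩
          simpa [hπ] using hmax.2
        · have hy := Finset.mem_filter.mp hy
          exact Finset.mem_filter.mpr ⟨by simpa using Finset.add_mem_add h0 hy.1, hy.2⟩
  have htrans : ∀ x a', a' ∈ A' → f B x ≤ f (A + B) (a' + x) := fun x a' ha' => by
    obtain ⟨a, ha, rfl⟩ := Finset.mem_image.mp ha'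
    refine Finset.card_le_card_of_injOn (fun b => a + b) (fun b hb => ?_)
      (fun _ _ _ _ h => add_left_cancel h)
    have hb := Finset.mem_filter.mp hb
    exact Finset.mem_filter.mpr ⟨Finset.add_mem_add ha hb.1, by simp [hπ, ← hb.2]⟩
  have hone : ∀ x ∈ A' + B₁, 1 ≤ f (A + B) x := fun x hx => by
    obtain ⟨a, ha, b, hb, rfl⟩ := Finset.mem_add.mp hx
    exact (Finset.mem_filter.mp hb).2.trans (htrans b a ha)
  have htwo : ∀ x ∈ A' + B₂, 2 ≤ f (A + B) x := fun x hx => by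
    obtain ⟨a, ha, b, hb, rfl⟩ := Finset.mem_add.mp hx
    exact (Finset.mem_filter.mp hb).2.trans (htrans b a ha)
  have hA'ne : A'.Nonempty := ⟨π 0, Finset.mem_image_of_mem _ h0⟩
  have hB₁ne : B₁.Nonempty := by
    obtain ⟨b, hb⟩ := hB
    exact ⟨π b, Finset.mem_filter.mpr
      ⟨Finset.mem_univ _, Finset.card_pos.mpr ⟨b, Finset.mem_filter.mpr ⟨hb, rfl⟩⟩⟩⟩
  have hfirst : B.card + (A' + B₁).card ≤ (A + B).card := by
    rw [hsum B, hsum (A + B), hcard, ← Finset.sum_add_distrib]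
    refine Finset.sum_le_sum fun x _ => ?_
    have h1 := hone x
    have h2 := hsucc x
    have h3 := hle x
    split_ifs with h
    · have := h1 h
      by_cases h4 : 1 ≤ f B x
      · exact h2 h4
      · omega
    · omega
  have hcd₁ := ZMod.cauchy_davenport (Fact.out : p.Prime) hA'ne hB₁ne
  by_cases hempty : B₂.Nonempty
  · have hcd₂ := ZMod.cauchy_davenport (Fact.out : p.Prime) hA'ne hempty
    have hsecond : (A' + B₁).card + (A' + B₂).card + B.card ≤
        (A + B).card + B₁.card + B₂.card := by
      rw [hsum B, hsum (A + B), hcard (A' + B₁), hcard (A' + B₂), hcard B₁, hcard B₂]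
      simp only [← Finset.sum_add_distrib]
      refine Finset.sum_le_sum fun x _ => ?_
      have h1 := hone x
      have h2 := htwo x
      have h3 := hle x
      have h4 : x ∈ B₁ ↔ 1 ≤ f B x := by simp [hB₁]
      have h5 : x ∈ B₂ ↔ 2 ≤ f B x := by simp [hB₂]
      split_ifs <;> grind
    have hsub : B₂.card ≤ B₁.card := Finset.card_le_card fun x hx => by
      simp only [hB₁, hB₂, Finset.mem_filter] at hx ⊢
      exact ⟨hx.1, by omega⟩
    have := hA'ne.card_pos
    have := hB₁ne.card_pos
    omega
  · have hBcard : B.card ≤ B₁.card := by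
      rw [hsum B, hcard B₁]
      refine Finset.sum_le_sum fun x _ => ?_
      have h4 : x ∈ B₁ ↔ 1 ≤ f B x := by simp [hB₁]
      have h5 : ¬ 2 ≤ f B x := fun h => hempty ⟨x, by simpa [hB₂] using h⟩
      split_ifs <;> grind
    omega

/-- If `A ⊆ [0, p]` with `p` prime contains both endpoints, then `A + B` satisfies Freiman's lower
bound up to a bounded error. -/
theorem card_add_of_subset_Icc_prime {p : ℕ} (hprime : p.Prime) {A B : Finset ℤ}
    (hA : A ⊆ Finset.Icc 0 (p : ℤ)) (h0 : 0 ∈ A) (hp : (p : ℤ) ∈ A) (hB : B.Nonempty) :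
    min (p + B.card) (min (A.card + 2 * B.card) (2 * A.card + B.card)) ≤ (A + B).card + 4 := by
  have := Fact.mk hprime
  have hcard : A.card ≤ (A.image (Int.cast : ℤ → ZMod p)).card + 1 := by
    have hinj : Set.InjOn (Int.cast : ℤ → ZMod p) (A.erase p) := fun x hx y hy h => by
      have hx' := Finset.mem_erase.mp hx
      have hy' := Finset.mem_erase.mp hy
      have hx2 := Finset.mem_Icc.mp (hA hx'.2)
      have hy2 := Finset.mem_Icc.mp (hA hy'.2)
      have h := (ZMod.intCast_eq_intCast_iff _ _ _).mp h
      have e := h.eq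
      rwa [Int.emod_eq_of_lt hx2.1 (lt_of_le_of_ne hx2.2 hx'.1),
        Int.emod_eq_of_lt hy2.1 (lt_of_le_of_ne hy2.2 hy'.1)] at e
    have h1 := Finset.card_image_of_injOn hinj
    have h2 := Finset.card_le_card
      (Finset.image_subset_image (f := (Int.cast : ℤ → ZMod p)) (A.erase_subset (p : ℤ)))
    have h3 := Finset.card_erase_add_one hp
    omega
  have := card_add_of_zero_mem_of_prime_mem h0 hp hB
  omega

/-- The union of the cells of side `h` indexed by `T` has measure `T.card * h`. -/
theorem volume_biUnion_Ico_int_mul (T : Finset ℤ) {h : ℝ} (hh : 0 < h) :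
    volume (⋃ k ∈ T, Ico ((k : ℝ) * h) ((k + 1) * h)) = ENNReal.ofReal (T.card * h) := by
  rw [measure_biUnion_finset]
  · have : ∀ k : ℤ, ((k : ℝ) + 1) * h - k * h = h := fun k => by ring
    simp only [Real.volume_Ico, this, Finset.sum_const, nsmul_eq_mul]
    rw [ENNReal.ofReal_mul (by positivity), ENNReal.ofReal_natCast]
  · intro i _ j _ hij
    refine Set.disjoint_left.mpr fun x hi hj => hij ?_
    have h1 : ((i : ℝ)) < j + 1 := lt_of_mul_lt_mul_right (hi.1.trans_lt hj.2) hh.le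
    have h2 : ((j : ℝ)) < i + 1 := lt_of_mul_lt_mul_right (hj.1.trans_lt hi.2) hh.le
    norm_cast at h1 h2
    omega
  · exact fun _ _ => measurableSet_Ico

theorem mem_Ico_floor_div_mul (x : ℝ) {h : ℝ} (hh : 0 < h) :
    x ∈ Ico ((⌊x / h⌋ : ℝ) * h) ((⌊x / h⌋ + 1) * h) :=
  ⟨(le_div_iff₀ hh).mp (Int.floor_le _), (div_lt_iff₀ hh).mp (Int.lt_floor_add_one _)⟩

/-- A bounded set of reals meets only finitely many cells of side `h`. -/
theorem finite_image_floor_div {A : Set ℝ} (hA : Bornology.IsBounded A) {h : ℝ} (hh : 0 < h) :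
    ((fun x : ℝ => ⌊x / h⌋) '' A).Finite := by
  refine (Set.finite_Icc ⌊sInf A / h⌋ ⌊sSup A / h⌋).subset ?_
  rintro _ ⟨x, hx, rfl⟩
  exact ⟨Int.floor_le_floor (by gcongr; exact csInf_le hA.bddBelow hx),
    Int.floor_le_floor (by gcongr; exact le_csSup hA.bddAbove hx)⟩

/-- The measure of a set is at most `h` times the number of cells of side `h` it meets. -/
theorem measureReal_le_card_mul {A : Set ℝ} {h : ℝ} (hh : 0 < h) {T : Finset ℤ}
    (hT : ∀ x ∈ A, ⌊x / h⌋ ∈ T) : volume.real A ≤ T.card * h := by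
  refine ENNReal.toReal_le_of_le_ofReal (by positivity) ?_
  rw [← volume_biUnion_Ico_int_mul T hh]
  refine measure_mono fun x hx => ?_
  exact mem_biUnion (hT x hx) (mem_Ico_floor_div_mul x hh)

/-- The sumset inequality for compact sets, with the sumset replaced by a thickening of it. -/
theorem min_le_measureReal_cthickening {A B : Set ℝ} {a : ℝ} (hB : IsCompact B)
    (hBne : B.Nonempty) (ha : 0 < a) (hA : A ⊆ Icc 0 a) (h0 : 0 ∈ A) (haA : a ∈ A)
    {p : ℕ} (hp : p.Prime) :
    min (a + volume.real B) (min (volume.real A + 2 * volume.real B)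
        (2 * volume.real A + volume.real B)) ≤
      volume.real (Metric.cthickening (2 * (a / p)) (A + B)) + 4 * (a / p) := by
  have hp0 : (0 : ℝ) < p := mod_cast hp.pos
  set h := a / p with hh_def
  have hh : 0 < h := by positivity
  have hph : p * h = a := by rw [hh_def]; field_simp
  have hAb : Bornology.IsBounded A := (Metric.isBounded_Icc 0 a).subset hA
  have hfA := finite_image_floor_div hAb hh
  have hfB := finite_image_floor_div hB.isBounded hh
  set A' := hfA.toFinset
  set B' := hfB.toFinset
  have hmA : ∀ x ∈ A, ⌊x / h⌋ ∈ A' := fun x hx => hfA.mem_toFinset.mpr ⟨x, hx, rfl⟩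
  have hmB : ∀ x ∈ B, ⌊x / h⌋ ∈ B' := fun x hx => hfB.mem_toFinset.mpr ⟨x, hx, rfl⟩
  have hB'ne : B'.Nonempty := hBne.imp' _ fun x hx => hmB x hx
  have hah : a / h = p := by rw [← hph]; field_simp
  have h0A' : 0 ∈ A' := by simpa using hmA 0 h0
  have hpA' : (p : ℤ) ∈ A' := by simpa [hah] using hmA a haA
  have hA'sub : A' ⊆ Finset.Icc 0 (p : ℤ) := by
    intro k hk
    obtain ⟨x, hx, rfl⟩ := hfA.mem_toFinset.mp hk
    refine Finset.mem_Icc.mpr ⟨Int.floor_nonneg.mpr (div_nonneg (hA hx).1 hh.le), ?_⟩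
    rw [← Int.floor_natCast (R := ℝ) p, ← hah]
    exact Int.floor_le_floor (by gcongr; exact (hA hx).2)
  have hbound := card_add_of_subset_Icc_prime hp hA'sub h0A' hpA' hB'ne
  have hcA := measureReal_le_card_mul hh hmA
  have hcB := measureReal_le_card_mul hh hmB
  have hcS : ((A' + B').card : ℝ) * h ≤ volume.real (Metric.cthickening (2 * h) (A + B)) := by
    have hfin : volume (Metric.cthickening (2 * h) (A + B)) ≠ ⊤ :=
      ((hAb.add hB.isBounded).cthickening).measure_lt_top.ne
    refine (ENNReal.ofReal_le_iff_le_toReal hfin).mp ?_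
    rw [← volume_biUnion_Ico_int_mul _ hh]
    refine measure_mono (iUnion₂_subset fun k hk s hs => ?_)
    obtain ⟨i, hi, j, hj, rfl⟩ := Finset.mem_add.mp hk
    obtain ⟨x, hx, rfl⟩ := hfA.mem_toFinset.mp hi
    obtain ⟨y, hy, rfl⟩ := hfB.mem_toFinset.mp hj
    refine Metric.mem_cthickening_of_dist_le s (x + y) _ _ (add_mem_add hx hy) ?_
    have h1 := mem_Ico_floor_div_mul x hh
    have h2 := mem_Ico_floor_div_mul y hh
    obtain ⟨h3, h4⟩ := hs
    push_cast at h3 h4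
    rw [Real.dist_eq, abs_le]
    constructor <;> nlinarith [h1.1, h1.2, h2.1, h2.2]
  have hbound' : (min (p + B'.card : ℝ) (min (A'.card + 2 * B'.card) (2 * A'.card + B'.card)))
      ≤ (A' + B').card + 4 := by exact_mod_cast hbound
  rcases min_le_iff.mp hbound' with h1 | h1
  · refine (min_le_left _ _).trans ?_
    nlinarith [mul_le_mul_of_nonneg_right h1 hh.le]
  · refine (min_le_right _ _).trans ?_
    rcases min_le_iff.mp h1 with h1 | h1
    · refine (min_le_left _ _).trans ?_
      nlinarith [mul_le_mul_of_nonneg_right h1 hh.le]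
    · refine (min_le_right _ _).trans ?_
      nlinarith [mul_le_mul_of_nonneg_right h1 hh.le]

/-- Ruzsa's lower bound for `|A + B|` in terms of the length of `[0, a]`, the convex hull of `A`. -/
theorem min_le_measureReal_add_of_subset_Icc_zero {A B : Set ℝ} {a : ℝ} (hAc : IsCompact A)
    (hB : IsCompact B) (hBne : B.Nonempty) (ha : 0 < a) (hA : A ⊆ Icc 0 a) (h0 : 0 ∈ A)
    (haA : a ∈ A) :
    min (a + volume.real B) (min (volume.real A + 2 * volume.real B)
        (2 * volume.real A + volume.real B)) ≤ volume.real (A + B) := by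
  have hlim : Tendsto (fun n : ℕ => a / n) atTop (nhds 0) := tendsto_const_div_atTop_nhds_zero_nat a
  have hS : IsCompact (A + B) := hAc.add hB
  have hthick : Tendsto (fun r => volume.real (Metric.cthickening r (A + B))) (nhds 0)
      (nhds (volume.real (A + B))) :=
    (ENNReal.tendsto_toReal hS.measure_lt_top.ne).comp (tendsto_measure_cthickening_of_isCompact hS)
  have hlim2 : Tendsto (fun n : ℕ => 2 * (a / n)) atTop (nhds 0) := by
    simpa using hlim.const_mul 2
  have htot := (hthick.comp hlim2).add (hlim.const_mul 4)
  rw [mul_zero, add_zero] at htot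
  refine ge_of_tendsto_of_frequently htot ?_
  exact (Nat.frequently_atTop_iff_infinite.mpr Nat.infinite_setOfPred_prime).mono fun p hp =>
    min_le_measureReal_cthickening hB hBne ha hA h0 haA hp

/-- Ruzsa's inequality for compact sets. -/
theorem min_le_measureReal_add {A B : Set ℝ} (hA : IsCompact A) (hB : IsCompact B)
    (hBne : B.Nonempty) {x y : ℝ} (hx : x ∈ A) (hy : y ∈ A) (hxy : x < y) :
    min (y - x + volume.real B) (min (volume.real A + 2 * volume.real B)
        (2 * volume.real A + volume.real B)) ≤ volume.real (A + B) := by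
  have hne : A.Nonempty := ⟨x, hx⟩
  set m := sInf A
  set M := sSup A
  have hmx : m ≤ x := csInf_le hA.bddBelow hx
  have hyM : y ≤ M := le_csSup hA.bddAbove hy
  have hvol : ∀ C : Set ℝ, volume.real (-m +ᵥ C) = volume.real C := fun C => by
    simp [Measure.real]
  have key := min_le_measureReal_add_of_subset_Icc_zero (A := -m +ᵥ A) (a := M - m)
    (hA.vadd _) hB hBne (by linarith) ?_ ?_ ?_
  · rw [vadd_add_assoc, hvol, hvol] at key
    exact (min_le_min_right _ (by linarith)).trans key
  · rintro _ ⟨z, hz, rfl⟩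
    have := csInf_le hA.bddBelow hz
    have := le_csSup hA.bddAbove hz
    constructor <;> simp only [vadd_eq_add] <;> linarith
  · exact ⟨m, hA.sInf_mem hne, by simp⟩
  · exact ⟨M, hA.sSup_mem hne, by simp only [vadd_eq_add]; ring⟩

/-- Inner regularity with prescribed points. -/
theorem exists_isCompact_subset_insert_pair {U : Set ℝ} (hU : MeasurableSet U)
    (hUfin : volume U ≠ ⊤) {x y : ℝ} (hx : x ∈ U) (hy : y ∈ U) {δ : ℝ} (hδ : 0 < δ) :
    ∃ K ⊆ U, IsCompact K ∧ x ∈ K ∧ y ∈ K ∧ volume.real U < volume.real K + δ := by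
  obtain ⟨K, hKU, hK, hlt⟩ := hU.exists_isCompact_lt_add hUfin
    (ENNReal.ofReal_pos.mpr hδ).ne'
  refine ⟨insert x (insert y K), ?_, (hK.insert y).insert x, by simp, by simp, ?_⟩
  · simp [insert_subset_iff, hx, hy, hKU]
  · have hc := (hK.insert y).insert x
    have h1 : volume U < volume (insert x (insert y K)) + ENNReal.ofReal δ :=
      hlt.trans_le (by gcongr; exact (subset_insert _ _).trans (subset_insert _ _))
    have h2 := (ENNReal.toReal_lt_toReal hUfin
      (by simpa using hc.measure_lt_top.ne)).mpr h1
    rwa [ENNReal.toReal_add hc.measure_lt_top.ne ENNReal.ofReal_ne_top,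
      ENNReal.toReal_ofReal hδ.le] at h2

/-- Ruzsa's inequality: a small sumset bounds the distance between points of the first summand. -/
theorem sub_add_measureReal_le_measureReal_add {U V : Set ℝ} (hU : MeasurableSet U)
    (hV : MeasurableSet V) (hVne : V.Nonempty) (hUfin : volume U ≠ ⊤) (hVfin : volume V ≠ ⊤)
    (hSfin : volume (U + V) ≠ ⊤)
    (hsum : volume.real (U + V) < volume.real U + volume.real V +
      min (volume.real U) (volume.real V)) {x y : ℝ} (hx : x ∈ U) (hy : y ∈ U) (hxy : x < y) :
    y - x + volume.real V ≤ volume.real (U + V) := by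
  obtain ⟨v, hv⟩ := hVne
  refine le_of_forall_pos_lt_add fun η hη => ?_
  set γ := volume.real U + volume.real V + min (volume.real U) (volume.real V) -
    volume.real (U + V) with hγ
  have hδ : 0 < min η (γ / 3) := lt_min hη (by linarith)
  obtain ⟨K, hKU, hK, hxK, hyK, hKm⟩ := exists_isCompact_subset_insert_pair hU hUfin hx hy hδ
  obtain ⟨L, hLV, hL, hvL, -, hLm⟩ := exists_isCompact_subset_insert_pair hV hVfin hv hv hδ
  have key := min_le_measureReal_add hK hL ⟨v, hvL⟩ hxK hyK hxy
  have hmono : volume.real (K + L) ≤ volume.real (U + V) :=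
    measureReal_mono (add_subset_add hKU hLV) hSfin
  have h1 := min_le_left η (γ / 3)
  have h2 := min_le_right η (γ / 3)
  have h3 := min_le_left (volume.real U) (volume.real V)
  have h4 := min_le_right (volume.real U) (volume.real V)
  rcases min_le_iff.mp key with h | h
  · linarith
  · rcases min_le_iff.mp h with h | h <;> linarith

/-- One-dimensional near-equality in the Brunn–Minkowski (Freiman) inequality: if
`U, V ⊆ ℝ` are nonempty Borel sets of finite measure, `ε < min(|U|, |V|)`, and
`|U + V| < |U| + |V| + ε`, then there is an interval `I ⊇ U` with `|I| < |U| + ε`. -/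
theorem one_dim_near_equality
    (U V : Set ℝ) (hU : MeasurableSet U) (hV : MeasurableSet V)
    (hUne : U.Nonempty) (hVne : V.Nonempty)
    (hUfin : volume U < ⊤) (hVfin : volume V < ⊤)
    (ε : ℝ) (hε : 0 < ε) (hεsmall : ENNReal.ofReal ε < min (volume U) (volume V))
    (hsum : volume (U + V) < volume U + volume V + ENNReal.ofReal ε) :
    ∃ I : Set ℝ, I.OrdConnected ∧ U ⊆ I ∧ volume I < volume U + ENNReal.ofReal ε := by
  have hUV : volume U + volume V + ENNReal.ofReal ε ≠ ⊤ := by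
    simp [hUfin.ne, hVfin.ne]
  have hSfin : volume (U + V) ≠ ⊤ := hsum.ne_top
  have hεU : ε < volume.real U :=
    (ENNReal.ofReal_lt_iff_lt_toReal hε.le hUfin.ne).mp (hεsmall.trans_le (min_le_left _ _))
  have hεV : ε < volume.real V :=
    (ENNReal.ofReal_lt_iff_lt_toReal hε.le hVfin.ne).mp (hεsmall.trans_le (min_le_right _ _))
  have hsum' : volume.real (U + V) < volume.real U + volume.real V + ε := by
    have h := (ENNReal.toReal_lt_toReal hSfin hUV).mpr hsum
    rwa [ENNReal.toReal_add (by simp [hUfin.ne, hVfin.ne]) ENNReal.ofReal_ne_top,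
      ENNReal.toReal_add hUfin.ne hVfin.ne, ENNReal.toReal_ofReal hε.le] at h
  set d := volume.real (U + V) - volume.real V with hd
  have hdist : ∀ x ∈ U, ∀ y ∈ U, x < y → y - x ≤ d := fun x hx y hy hxy => by
    have := sub_add_measureReal_le_measureReal_add hU hV hVne hUfin.ne hVfin.ne hSfin
      (hsum'.trans (by have := lt_min hεU hεV; linarith)) hx hy hxy
    linarith
  have hdU : d < volume.real U + ε := by linarith
  obtain ⟨u, hu⟩ := hUne
  have hb : Bornology.IsBounded U := by
    refine Metric.isBounded_iff.mpr ⟨max d 0, fun x hx y hy => ?_⟩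
    rw [Real.dist_eq]
    rcases lt_trichotomy x y with h | h | h
    · rw [abs_sub_comm, abs_of_pos (by linarith)]
      exact (hdist x hx y hy h).trans (le_max_left _ _)
    · simp [h]
    · rw [abs_of_pos (by linarith)]
      exact (hdist y hy x hx h).trans (le_max_left _ _)
  refine ⟨Icc (sInf U) (sSup U), ordConnected_Icc, fun x hx =>
    ⟨csInf_le hb.bddBelow hx, le_csSup hb.bddAbove hx⟩, ?_⟩
  have hpos : 0 < volume.real U + ε := by linarith
  have hlen : sSup U - sInf U < volume.real U + ε := by
    refine lt_of_le_of_lt ?_ (max_lt hdU hpos)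
    rw [sub_le_iff_le_add']
    refine csSup_le ⟨u, hu⟩ fun y hy => ?_
    rw [← sub_le_iff_le_add]
    refine le_csInf ⟨u, hu⟩ fun x hx => ?_
    rcases lt_or_ge x y with h | h
    · have := (hdist x hx y hy h).trans (le_max_left d 0)
      linarith
    · have := le_max_right d 0
      linarith
  rw [Real.volume_Icc, ← ENNReal.ofReal_toReal hUfin.ne, ← ENNReal.ofReal_add (by positivity) hε.le]
  exact (ENNReal.ofReal_lt_ofReal_iff hpos).mpr hlen
end
end
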